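/- arXiv:1312.6438 — 5 statements merged into one kernel-verified Lean document; each statement's English description precedes it below -/
import Mathlib

section
/- For any finite set A of real numbers, the quotient set of the difference set satisfies |(A−A)/(A−A)| ≫ |A|², i.e., there is an absolute constant c > 0 such that |{(a−b)/(c−d) : a,b,c,d ∈ A, c ≠ d}| ≥ c|A|² whenever |A| ≥ 2. -/
open Finset

/-- The linear functional whose level sets are the lines of slope `t`. -/
noncomputable def slf (t : ℝ) (p : ℝ × ℝ) : ℝ := p.2 - t * p.1

/-- `S` contains all finite slopes determined by `P`. -/
def SlopeClosed (P : Finset (ℝ × ℝ)) (S : Finset ℝ) : Prop :=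
  ∀ p ∈ P, ∀ q ∈ P, p.1 ≠ q.1 → (p.2 - q.2) / (p.1 - q.1) ∈ S

lemma slf_eq_of_two {s t : ℝ} (h : s ≠ t) {p q : ℝ × ℝ} (h1 : slf s p = slf s q)
    (h2 : slf t p = slf t q) : p = q := by
  unfold slf at *
  have h3 : (s - t) * (p.1 - q.1) = 0 := by linarith
  have h4 : p.1 = q.1 := by
    rcases mul_eq_zero.1 h3 with h | h
    · exact absurd (by linarith) ‹s ≠ t›
    · linarith
  rw [h4] at h1
  exact Prod.ext h4 (by linarith)

lemma slope_between {P : Finset (ℝ × ℝ)} {S : Finset ℝ} (hS : SlopeClosed P S)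
    {p q : ℝ × ℝ} (hp : p ∈ P) (hq : q ∈ P) {a b : ℝ} (hab : a < b)
    (h1 : slf a p < slf a q) (h2 : slf b q ≤ slf b p) :
    ∃ s ∈ S, a < s ∧ s ≤ b ∧ slf s p = slf s q := by
  unfold slf at *
  have hx : 0 < q.1 - p.1 := by
    by_contra hc
    push Not at hc
    nlinarith
  refine ⟨_, hS q hq p hp (by intro h; linarith), ?_, ?_, ?_⟩
  · rw [lt_div_iff₀ hx]; linarith
  · rw [div_le_iff₀ hx]; linarith
  · field_simp
    ring

lemma exists_low (P : Finset (ℝ × ℝ)) (f : ℝ × ℝ → ℝ) (hf : Set.InjOn f P) (n : ℕ)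
    (hn : n ≤ P.card) :
    ∃ L ⊆ P, L.card = n ∧ ∀ p ∈ L, ∀ q ∈ P, q ∉ L → f p < f q := by
  induction n with
  | zero => exact ⟨∅, by simp, by simp, by simp⟩
  | succ n ih =>
    obtain ⟨L, hL, hc, h⟩ := ih (by omega)
    have hne : (P \ L).Nonempty := by
      rw [← Finset.card_pos, Finset.card_sdiff_of_subset hL]; omega
    obtain ⟨m, hm, hmin⟩ := Finset.exists_min_image (P \ L) f hne
    rw [Finset.mem_sdiff] at hm
    refine ⟨insert m L, ?_, ?_, ?_⟩
    · exact Finset.insert_subset hm.1 hL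
    · rw [Finset.card_insert_of_notMem hm.2, hc]
    · intro p hp q hq hqL
      rw [Finset.mem_insert, not_or] at hqL
      rcases Finset.mem_insert.1 hp with rfl | hp
      · refine lt_of_le_of_ne (hmin q (by simp [hq, hqL.2])) ?_
        intro he
        exact hqL.1 (hf hm.1 hq he).symm
      · exact h p hp q hq hqL.2

lemma exists_enum (S : Finset ℝ) :
    ∃ σ : ℕ → ℝ, StrictMono σ ∧ ∀ s ∈ S, ∃ i < S.card, σ i = s := by
  induction S using Finset.induction_on_max with
  | empty => exact ⟨fun n => n, Nat.strictMono_cast, by simp⟩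
  | insert a S ha ih =>
    obtain ⟨σ, hσ, h⟩ := ih
    have haS : a ∉ S := fun h => lt_irrefl _ (ha a h)
    by_cases h0 : S.card = 0
    · rw [Finset.card_eq_zero] at h0
      subst h0
      refine ⟨fun n => a + n, fun i j hij => by simpa using hij, ?_⟩
      intro s hs
      have hs' : s = a := by simpa using hs
      exact ⟨0, by simp, by simp [hs']⟩
    · -- the enumeration takes values in S below S.card
      have himg : ∀ i < S.card, σ i ∈ S := by
        have hsub : S ⊆ (Finset.range S.card).image σ := by
          intro s hs
          obtain ⟨i, hi, rfl⟩ := h s hs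
          exact Finset.mem_image_of_mem _ (Finset.mem_range.2 hi)
        have heq := Finset.eq_of_subset_of_card_le hsub
          (Finset.card_image_le.trans (by simp))
        intro i hi
        rw [heq]
        exact Finset.mem_image_of_mem _ (Finset.mem_range.2 hi)
      refine ⟨fun i => if i < S.card then σ i else a + ((i : ℝ) - S.card), ?_, ?_⟩
      · intro i j hij
        have hij' : (i : ℝ) < j := by exact_mod_cast hij
        dsimp only
        split_ifs with h1 h2 h2
        · exact hσ hij
        · have := ha _ (himg i h1)
          have h3 : (S.card : ℝ) ≤ j := by exact_mod_cast not_lt.1 h2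
          linarith
        · omega
        · linarith
      · intro s hs
        rw [Finset.card_insert_of_notMem haS]
        rcases Finset.mem_insert.1 hs with rfl | hs
        · exact ⟨S.card, by omega, by simp⟩
        · obtain ⟨i, hi, rfl⟩ := h s hs
          exact ⟨i, by omega, by simp [hi]⟩

lemma sum_bound (d : ℕ → ℕ) (k : ℕ) (hk : ∀ i, d i ≤ k)
    (h : ∀ i j, i < j → d j ≠ 0 → (∀ m, i < m → m < j → d m = 0) → d i ≤ j - i) (M : ℕ) :
    ∑ i ∈ range M, d i ≤ M + k := by
  have key : ∀ M, (∑ i ∈ range M, d i = 0) ∨ ∃ l < M, (∀ m, l < m → m < M → d m = 0) ∧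
      ∑ i ∈ range M, d i ≤ l + d l := by
    intro M
    induction M with
    | zero => left; simp
    | succ M ih =>
      rw [Finset.sum_range_succ]
      by_cases hM : d M = 0
      · rcases ih with ih | ⟨l, hl, h1, h2⟩
        · left; omega
        · right
          refine ⟨l, by omega, ?_, by omega⟩
          intro m hm hm'
          rcases Nat.lt_succ_iff_lt_or_eq.1 hm' with h3 | rfl
          · exact h1 m hm h3
          · exact hM
      · right
        refine ⟨M, by omega, fun m h1 h2 => by omega, ?_⟩
        rcases ih with ih | ⟨l, hl, h1, h2⟩
        · omega
        · have := h l M hl hM h1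
          omega
  rcases key M with h0 | ⟨l, hl, _, h2⟩
  · omega
  · have := hk l
    omega

/-- Points of opposite type at a crossing lie on a common line. -/
lemma cross_eq {P : Finset (ℝ × ℝ)} {S : Finset ℝ} (hS : SlopeClosed P S)
    {a b s : ℝ} (hab : a < b) (hs : ∀ u ∈ S, a < u → u ≤ b → u = s)
    {p q : ℝ × ℝ} (hp : p ∈ P) (hq : q ∈ P) (h1 : slf a p < slf a q) (h2 : slf b q < slf b p) :
    slf s p = slf s q := by
  obtain ⟨u, hu, h3, h4, h5⟩ := slope_between hS hp hq hab h1 h2.le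
  rw [← hs u hu h3 h4]; exact h5

lemma inj_count {S : Finset ℝ} {σ : ℕ → ℝ} (hσ : StrictMono σ)
    (hS : ∀ s ∈ S, ∃ i < S.card, σ i = s) {i j : ℕ} (D : Finset (ℝ × ℝ)) (q : ℝ × ℝ) (v : ℝ)
    (hv : ∀ p ∈ D, slf (σ i) p = v)
    (h : ∀ p ∈ D, ∃ s ∈ S, σ i < s ∧ s ≤ σ j ∧ slf s p = slf s q) : D.card ≤ j - i := by
  have h' : ∀ p ∈ D, ∃ m, i < m ∧ m ≤ j ∧ slf (σ m) p = slf (σ m) q := by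
    intro p hp
    obtain ⟨s, hs, h1, h2, h3⟩ := h p hp
    obtain ⟨m, _, rfl⟩ := hS s hs
    exact ⟨m, hσ.lt_iff_lt.1 h1, hσ.le_iff_le.1 h2, h3⟩
  choose! g hg using h'
  rw [← Nat.card_Ioc]
  refine Finset.card_le_card_of_injOn g ?_ ?_
  · intro p hp
    have := hg p hp
    simp [this.1, this.2.1]
  · intro p hp p' hp' he
    have h1 := hg p hp
    have h2 := hg p' hp'
    rw [← he] at h2
    refine slf_eq_of_two (s := σ i) (t := σ (g p)) (hσ h1.1).ne ?_ (h1.2.2.trans h2.2.2.symm)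
    rw [hv p hp, hv p' hp']

theorem directions_bound (P : Finset (ℝ × ℝ)) (S : Finset ℝ) (hS : SlopeClosed P S) (k n : ℕ)
    (hn : 2 * n ≤ P.card)
    (hk : ∀ s v, (P.filter (fun p => slf s p = v)).card ≤ k)
    (hkx : ∀ v, (P.filter (fun p => p.1 = v)).card ≤ k) : n ≤ S.card + 2 * k := by
  obtain ⟨σ, hσ, hσS⟩ := exists_enum S
  obtain ⟨t, ht1, ht2⟩ : ∃ t : ℕ → ℝ, (∀ i, t i < σ i) ∧ ∀ i, σ i < t (i + 1) := by
    refine ⟨fun i => Nat.casesOn i (σ 0 - 1) (fun m => (σ m + σ (m + 1)) / 2), ?_, ?_⟩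
    · intro i
      cases i with
      | zero => simp
      | succ m => have := hσ (Nat.lt_succ_self m); simp only [Nat.succ_eq_add_one] at *; linarith
    · intro i
      have := hσ (Nat.lt_succ_self i); simp only [Nat.succ_eq_add_one] at *; linarith
  have hlt : ∀ i m, t i < σ m → i ≤ m := by
    intro i m h
    by_contra hc
    obtain ⟨l, rfl⟩ : ∃ l, i = l + 1 := ⟨i - 1, by omega⟩
    have := ht2 l
    have : σ m ≤ σ l := hσ.monotone (by omega)
    linarith
  have hlt' : ∀ i m, σ m ≤ t i → m < i := by
    intro i m h
    by_contra hc
    have := ht1 i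
    have : σ i ≤ σ m := hσ.monotone (by omega)
    linarith
  have htS : ∀ i, t i ∉ S := by
    intro i hi
    obtain ⟨m, _, hm⟩ := hσS _ hi
    have h1 := hlt' i m hm.le
    have h2 := ht1 m
    have h3 := ht2 m
    have h4 : t i ≤ σ i := (ht1 i).le
    obtain ⟨l, rfl⟩ : ∃ l, i = l + 1 := ⟨i - 1, by omega⟩
    have := ht2 l
    have : σ m ≤ σ l := hσ.monotone (by omega)
    linarith
  have hinj : ∀ i, Set.InjOn (slf (t i)) P := by
    intro i p hp q hq he
    by_contra hne
    have hx : p.1 ≠ q.1 := by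
      intro hx
      apply hne
      unfold slf at he
      rw [hx] at he
      exact Prod.ext hx (by linarith)
    apply htS i
    have := hS p hp q hq hx
    convert this using 1
    unfold slf at he
    rw [eq_div_iff (sub_ne_zero.2 hx)]
    linarith
  have hL : ∀ i, ∃ L ⊆ P, L.card = n ∧ ∀ p ∈ L, ∀ q ∈ P, q ∉ L → slf (t i) p < slf (t i) q :=
    fun i => exists_low P _ (hinj i) n (by omega)
  choose L hLP hLc hLlt using hL
  have htt : ∀ i, t i < t (i + 1) := fun i => (ht1 i).trans (ht2 i)
  have honly : ∀ i, ∀ u ∈ S, t i < u → u ≤ t (i + 1) → u = σ i := by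
    intro i u hu h1 h2
    obtain ⟨m, _, rfl⟩ := hσS u hu
    have := hlt _ _ h1
    have := hlt' _ _ h2
    rw [show m = i by omega]
  have hcross : ∀ i, ∀ p ∈ L i \ L (i + 1), ∀ q ∈ L (i + 1) \ L i,
      slf (σ i) p = slf (σ i) q := by
    intro i p hp q hq
    rw [Finset.mem_sdiff] at hp hq
    exact cross_eq hS (htt i) (honly i) (hLP _ hp.1) (hLP _ hq.1)
      (hLlt i p hp.1 q (hLP _ hq.1) hq.2) (hLlt (i + 1) q hq.1 p (hLP _ hp.1) hp.2)
  have hcardeq : ∀ i, (L (i + 1) \ L i).card = (L i \ L (i + 1)).card := by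
    intro i
    exact Finset.card_sdiff_comm (by rw [hLc, hLc])
  -- weak separation on the slopes adjacent to the index
  have hright : ∀ i, ∀ p ∈ L i, ∀ q ∈ P, q ∉ L i → slf (σ i) p ≤ slf (σ i) q := by
    intro i p hp q hq hqL
    by_contra hc
    push Not at hc
    obtain ⟨u, hu, h1, h2, h3⟩ := slope_between hS (hLP _ hp) hq (ht1 i) (hLlt i p hp q hq hqL) hc.le
    have := honly i u hu h1 (h2.trans (ht2 i).le)
    subst this
    linarith
  have hleft : ∀ i, ∀ p ∈ L (i + 1), ∀ q ∈ P, q ∉ L (i + 1) → slf (σ i) p ≤ slf (σ i) q := by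
    intro i p hp q hq hqL
    by_contra hc
    push Not at hc
    have h0 := hLlt (i + 1) p hp q hq hqL
    obtain ⟨u, hu, h1, h2, h3⟩ := slope_between hS hq (hLP _ hp) (ht2 i) hc h0.le
    have := honly i u hu ((ht1 i).trans h1) h2
    linarith
  have hsum := sum_bound (fun i => (L i \ L (i + 1)).card) k ?_ ?_ S.card
  · -- conclude
    have htri : ∀ M, (L 0 \ L M).card ≤ ∑ i ∈ range M, (L i \ L (i + 1)).card := by
      intro M
      induction M with
      | zero => simp
      | succ M ih =>
        rw [Finset.sum_range_succ]
        refine le_trans (le_trans (Finset.card_le_card ?_) (Finset.card_union_le (L 0 \ L M) (L M \ L (M + 1)))) (by omega)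
        intro x hx
        simp only [Finset.mem_sdiff, Finset.mem_union] at *
        tauto
    have h1 := htri S.card
    have h2 : (L 0 ∩ L S.card).card ≤ k := by
      by_cases hne : (L 0 ∩ L S.card).Nonempty
      · obtain ⟨z, hz⟩ := hne
        have hle : ∀ p ∈ L 0 ∩ L S.card, ∀ p' ∈ L 0 ∩ L S.card, ¬ p.1 < p'.1 := by
          intro p hp p' hp' hlt1
          have hcov : P ⊆ L 0 ∪ L S.card := by
            intro q hq
            by_contra hc
            rw [Finset.mem_union, not_or] at hc
            rw [Finset.mem_inter] at hp hp'
            have e1 := hLlt _ p' hp'.1 q hq hc.1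
            have e2 := hLlt _ p hp.2 q hq hc.2
            unfold slf at e1 e2
            have f1 : p'.1 ≤ q.1 := by
              by_contra hx
              push Not at hx
              obtain ⟨m, _, hm⟩ := hσS _ (hS p' (hLP _ hp'.1) q hq hx.ne')
              have g1 : t 0 < σ m := (ht1 0).trans_le (hσ.monotone (Nat.zero_le m))
              rw [hm, lt_div_iff₀ (by linarith)] at g1
              linarith
            have f2 : q.1 ≤ p.1 := by
              by_contra hx
              push Not at hx
              obtain ⟨m, hmM, hm⟩ := hσS _ (hS q hq p (hLP _ hp.1) hx.ne')
              have g1 : σ m < t S.card := by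
                obtain ⟨l, hl⟩ : ∃ l, S.card = l + 1 := ⟨S.card - 1, by omega⟩
                rw [hl]
                exact (hσ.monotone (by omega : m ≤ l)).trans_lt (ht2 l)
              rw [hm, div_lt_iff₀ (by linarith)] at g1
              linarith
            linarith
          have c1 := Finset.card_le_card hcov
          have c2 := Finset.card_union_add_card_inter (L 0) (L S.card)
          have c3 : 0 < (L 0 ∩ L S.card).card := Finset.card_pos.2 ⟨p, hp⟩
          rw [hLc, hLc] at c2
          omega
        refine le_trans (Finset.card_le_card ?_) (hkx z.1)
        intro p hp
        rw [Finset.mem_filter]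
        refine ⟨hLP 0 (Finset.mem_inter.1 hp).1, ?_⟩
        exact le_antisymm (not_lt.1 (hle z hz p hp)) (not_lt.1 (hle p hp z hz))
      · rw [Finset.not_nonempty_iff_eq_empty] at hne
        simp [hne]
    have h3 := Finset.card_sdiff_add_card_inter (L 0) (L S.card)
    rw [hLc] at h3
    omega
  · intro i
    by_cases hne : (L (i + 1) \ L i).Nonempty
    · obtain ⟨q, hq⟩ := hne
      refine le_trans (Finset.card_le_card ?_) (hk (σ i) (slf (σ i) q))
      intro p hp
      rw [Finset.mem_filter]
      exact ⟨hLP i (Finset.mem_sdiff.1 hp).1, hcross i p hp q hq⟩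
    · rw [Finset.not_nonempty_iff_eq_empty] at hne
      rw [← hcardeq, hne]; simp
  · intro i j hij hj hz
    by_cases hi : (L i \ L (i + 1)).card = 0
    · omega
    have hLeq : ∀ m, i + 1 ≤ m → m ≤ j → L m = L (i + 1) := by
      intro m hm
      induction m, hm using Nat.le_induction with
      | base => intro _; rfl
      | succ m hm ih =>
        intro hmj
        rw [← ih (by omega)]
        have h0 := hz m (by omega) (by omega)
        rw [Finset.card_eq_zero, Finset.sdiff_eq_empty_iff_subset] at h0
        exact (Finset.eq_of_subset_of_card_le h0 (by rw [hLc, hLc])).symm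
    have hE : L j = L (i + 1) := hLeq j hij le_rfl
    obtain ⟨q, hq⟩ : (L j \ L (j + 1)).Nonempty := Finset.card_pos.1 (by omega)
    obtain ⟨r, hr⟩ : (L (j + 1) \ L j).Nonempty :=
      Finset.card_pos.1 (by rw [hcardeq]; omega)
    have hqr := hcross j q hq r hr
    obtain ⟨r0, hr0⟩ : (L i \ L (i + 1)).Nonempty := Finset.card_pos.1 (by omega)
    obtain ⟨l0, hl0⟩ : (L (i + 1) \ L i).Nonempty :=
      Finset.card_pos.1 (by rw [hcardeq]; omega)
    have hvl : ∀ p ∈ L (i + 1) \ L i, slf (σ i) p = slf (σ i) r0 :=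
      fun p hp => (hcross i r0 hr0 p hp).symm
    have hvr : ∀ p ∈ L i \ L (i + 1), slf (σ i) p = slf (σ i) r0 :=
      fun p hp => (hcross i p hp l0 hl0).trans (hvl l0 hl0)
    rw [Finset.mem_sdiff] at hq hr
    have hqP := hLP _ hq.1
    have hrP := hLP _ hr.1
    have hr0' := Finset.mem_sdiff.1 hr0
    have hl0' := Finset.mem_sdiff.1 hl0
    have hqle : slf (σ i) q ≤ slf (σ i) r0 :=
      hleft i q (hE ▸ hq.1) r0 (hLP _ hr0'.1) hr0'.2
    rcases hqle.lt_or_eq with hlt1 | heq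
    · rw [← hcardeq]
      refine inj_count hσ hσS _ q _ hvl ?_
      intro p hp
      have hp' := Finset.mem_sdiff.1 hp
      have h2 : slf (σ j) p ≤ slf (σ j) q := by
        rw [hqr]
        exact hright j p (hE ▸ hp'.1) r hrP hr.2
      obtain ⟨s, hs, a1, a2, a3⟩ := slope_between hS hqP (hLP _ hp'.1) (hσ hij)
        (by rw [hvl p hp]; exact hlt1) h2
      exact ⟨s, hs, a1, a2, a3.symm⟩
    · refine inj_count hσ hσS _ r _ hvr ?_
      intro p hp
      have hp' := Finset.mem_sdiff.1 hp
      have h2 : slf (σ j) r ≤ slf (σ j) p := by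
        rw [← hqr]
        exact hright j q hq.1 p (hLP _ hp'.1) (hE ▸ hp'.2)
      have h3 : slf (σ i) q ≤ slf (σ i) r := hleft i q (hE ▸ hq.1) r hrP (hE ▸ hr.2)
      have h4 : slf (σ i) q ≠ slf (σ i) r := by
        intro h4
        have := slf_eq_of_two (hσ hij).ne h4 hqr
        exact hr.2 (this ▸ hq.1)
      exact slope_between hS (hLP _ hp'.1) hrP (hσ hij)
        (by rw [hvr p hp, ← heq]; exact lt_of_le_of_ne h3 h4) h2

theorem stmt5 : ∃ c > (0:ℝ), ∀ A : Finset ℝ, 2 ≤ A.card →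
    c * (A.card : ℝ)^2 ≤
      (((((A ×ˢ A) ×ˢ (A ×ˢ A)).filter (fun q => q.2.1 ≠ q.2.2)).image
        (fun q => (q.1.1 - q.1.2) / (q.2.1 - q.2.2))).card : ℝ) := by
  refine ⟨1 / 64, by norm_num, ?_⟩
  intro A hA
  set S := ((((A ×ˢ A) ×ˢ (A ×ˢ A)).filter (fun q => q.2.1 ≠ q.2.2)).image
        (fun q => (q.1.1 - q.1.2) / (q.2.1 - q.2.2))) with hSdef
  have hS : SlopeClosed (A ×ˢ A) S := by
    intro p hp q hq hx
    rw [Finset.mem_product] at hp hq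
    rw [hSdef, Finset.mem_image]
    refine ⟨((p.2, q.2), (p.1, q.1)), ?_, rfl⟩
    simp [hp.1, hp.2, hq.1, hq.2, hx]
  have hpos : 1 ≤ S.card := by
    obtain ⟨a, ha, b, hb, hab⟩ := Finset.one_lt_card.1 (show 1 < A.card by omega)
    exact Finset.card_pos.2 ⟨_, hS (a, a) (by simp [ha]) (b, b) (by simp [hb]) hab⟩
  have hmain := directions_bound (A ×ˢ A) S hS A.card (A.card ^ 2 / 2)
    (by rw [Finset.card_product, ← sq]; omega) ?_ ?_
  · have h1 : A.card ^ 2 ≤ 2 * S.card + 4 * A.card + 1 := by omega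
    have h1' : (A.card : ℝ) ^ 2 ≤ 2 * S.card + 4 * A.card + 1 := by exact_mod_cast h1
    have h2 : (1 : ℝ) ≤ S.card := by exact_mod_cast hpos
    have h3 : (2 : ℝ) ≤ A.card := by exact_mod_cast hA
    by_cases h8 : (A.card : ℝ) ≤ 8
    · nlinarith
    · push Not at h8
      nlinarith
  · intro s v
    refine Finset.card_le_card_of_injOn Prod.fst ?_ ?_
    · intro p hp
      simp only [Finset.mem_coe, Finset.mem_filter, Finset.mem_product] at hp
      exact hp.1.1
    · intro p hp q hq he
      simp only [Finset.mem_coe, Finset.mem_filter, Finset.mem_product] at hp hq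
      have := hp.2.trans hq.2.symm
      unfold slf at this
      rw [he] at this
      exact Prod.ext he (by linarith)
  · intro v
    refine Finset.card_le_card_of_injOn Prod.snd ?_ ?_
    · intro p hp
      simp only [Finset.mem_coe, Finset.mem_filter, Finset.mem_product] at hp
      exact hp.1.2
    · intro p hp q hq he
      simp only [Finset.mem_coe, Finset.mem_filter, Finset.mem_product] at hp hq
      exact Prod.ext (hp.2.trans hq.2.symm) he
end

section
/- For any finite set A of real numbers, |{(a2·b2 − a1·b1)/(a1 − a2) : a1, a2, b1, b2 ∈ A, a1 ≠ a2}| ≫ |A|². -/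
open Finset

/-- the linear functional in direction `t` -/
noncomputable def ff (t : ℝ) (p : ℝ × ℝ) : ℝ := p.2 + t * p.1

lemma exists_lower (P : Finset (ℝ × ℝ)) (g : ℝ × ℝ → ℝ) (m : ℕ) (hm : m ≤ P.card) :
    ∃ L ⊆ P, L.card = m ∧ ∀ p ∈ L, ∀ q ∈ P, q ∉ L → g p ≤ g q := by
  induction m with
  | zero => exact ⟨∅, by simp, by simp, by simp⟩
  | succ m ih =>
    obtain ⟨L, hLP, hc, hL⟩ := ih (by omega)
    have hne : (P \ L).Nonempty := by
      rw [← Finset.card_pos, Finset.card_sdiff_of_subset hLP]; omega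
    obtain ⟨z, hz, hmin⟩ := Finset.exists_min_image (P \ L) g hne
    rw [Finset.mem_sdiff] at hz
    refine ⟨insert z L, ?_, ?_, ?_⟩
    · intro x hx
      rcases Finset.mem_insert.1 hx with rfl | h
      · exact hz.1
      · exact hLP h
    · rw [Finset.card_insert_of_notMem hz.2, hc]
    · intro p hp q hq hqL
      rw [Finset.mem_insert, not_or] at hqL
      rcases Finset.mem_insert.1 hp with rfl | h
      · exact hmin q (Finset.mem_sdiff.2 ⟨hq, hqL.2⟩)
      · exact hL p h q hq hqL.2

lemma exists_seq (D : Finset ℝ) : ∀ u : ℝ, (∀ x ∈ D, x < u) → ∃ d t : ℕ → ℝ,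
    (∀ i < D.card, t i < d i ∧ d i < t (i+1)) ∧ (∀ x ∈ D, ∃ i < D.card, d i = x) ∧
    t D.card < u := by
  induction D using Finset.induction_on_max with
  | empty => intro u _; exact ⟨fun _ => 0, fun _ => u - 1, by simp, by simp, by simp⟩
  | insert a D hmax ih =>
    intro u hu
    have ha : a ∉ D := fun h => lt_irrefl _ (hmax a h)
    obtain ⟨d, t, h1, h2, h3⟩ := ih a hmax
    have hau : a < u := hu a (by simp)
    rw [Finset.card_insert_of_notMem ha]
    refine ⟨Function.update d D.card a, Function.update t (D.card + 1) ((a+u)/2), ?_, ?_, ?_⟩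
    · intro i hi
      rcases Nat.lt_succ_iff_lt_or_eq.1 hi with h | h
      · have e1 : i ≠ D.card := by omega
        have e2 : i ≠ D.card + 1 := by omega
        have e3 : i + 1 ≠ D.card + 1 := by omega
        simpa only [Function.update_of_ne e1, Function.update_of_ne e2,
          Function.update_of_ne e3] using h1 i h
      · subst h
        have e2 : D.card ≠ D.card + 1 := by omega
        rw [Function.update_of_ne e2, Function.update_self, Function.update_self]
        exact ⟨h3, by linarith⟩
    · intro x hx
      rcases Finset.mem_insert.1 hx with rfl | h
      · exact ⟨D.card, by omega, by simp⟩
      · obtain ⟨i, hi, rfl⟩ := h2 x h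
        exact ⟨i, by omega, by rw [Function.update_of_ne (by omega)]⟩
    · simp only [Function.update_self]; linarith

/-- the slope -/
noncomputable def sl (p q : ℝ × ℝ) : ℝ := (q.2 - p.2) / (p.1 - q.1)

lemma sl_spec {p q : ℝ × ℝ} (h : p.1 ≠ q.1) : ff (sl p q) p = ff (sl p q) q := by
  have : p.1 - q.1 ≠ 0 := sub_ne_zero.2 h
  unfold ff sl
  field_simp
  ring

lemma sl_eq {p q : ℝ × ℝ} (h : p.1 ≠ q.1) {t : ℝ} (ht : ff t p = ff t q) : t = sl p q := by
  have : p.1 - q.1 ≠ 0 := sub_ne_zero.2 h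
  unfold ff at ht
  unfold sl
  rw [eq_div_iff this]
  linarith

lemma cross1 {p q : ℝ × ℝ} {s t : ℝ} (hst : s < t) (h1 : ff s p < ff s q) (h2 : ff t q ≤ ff t p) :
    q.1 < p.1 ∧ s < sl p q ∧ sl p q ≤ t := by
  unfold ff at h1 h2
  have hx : q.1 < p.1 := by
    by_contra h
    push Not at h
    nlinarith [mul_nonneg (sub_nonneg.2 hst.le) (sub_nonneg.2 h)]
  have : 0 < p.1 - q.1 := by linarith
  refine ⟨hx, ?_, ?_⟩
  · unfold sl; rw [lt_div_iff₀ this]; linarith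
  · unfold sl; rw [div_le_iff₀ this]; linarith

lemma cross2 {p q : ℝ × ℝ} {s t : ℝ} (hst : s < t) (h1 : ff s p ≤ ff s q) (h2 : ff t q < ff t p) :
    q.1 < p.1 ∧ s ≤ sl p q ∧ sl p q < t := by
  unfold ff at h1 h2
  have hx : q.1 < p.1 := by
    by_contra h
    push Not at h
    nlinarith [mul_nonneg (sub_nonneg.2 hst.le) (sub_nonneg.2 h)]
  have : 0 < p.1 - q.1 := by linarith
  refine ⟨hx, ?_, ?_⟩
  · unfold sl; rw [le_div_iff₀ this]; linarith
  · unfold sl; rw [div_lt_iff₀ this]; linarith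

lemma ff_two {p q : ℝ × ℝ} {s t : ℝ} (hst : s ≠ t) (h1 : ff s p = ff s q) (h2 : ff t p = ff t q) :
    p = q := by
  unfold ff at h1 h2
  have h : (s - t) * (p.1 - q.1) = 0 := by linarith
  have hx : p.1 = q.1 := by
    rcases mul_eq_zero.1 h with h | h
    · exact absurd (sub_eq_zero.1 h) hst
    · exact sub_eq_zero.1 h
  refine Prod.ext hx ?_
  rw [hx] at h1; linarith

/-- Slopes from a point off a line to points of the line are distinct. -/
lemma sl_inj {p c c' : ℝ × ℝ} {s : ℝ} (h : ff s c = ff s c') (hp : ff s p ≠ ff s c)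
    (h1 : p.1 ≠ c.1) (h2 : p.1 ≠ c'.1) (e : sl p c = sl p c') : c = c' := by
  have a1 := sl_spec h1
  have a2 := sl_spec h2
  rw [← e] at a2
  refine ff_two (s := s) (t := sl p c) ?_ h (a1.symm.trans a2)
  intro hs
  rw [← hs] at a1
  exact hp a1

lemma sl_symm (p q : ℝ × ℝ) : sl p q = sl q p := by
  unfold sl
  rw [← neg_sub p.2 q.2, ← neg_sub q.1 p.1, neg_div_neg_eq]

theorem ungar (P : Finset (ℝ × ℝ)) (D : Finset ℝ) (n m : ℕ)
    (hD : ∀ p ∈ P, ∀ q ∈ P, p.1 ≠ q.1 → sl p q ∈ D)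
    (hcol : ∀ x, (P.filter (fun p => p.1 = x)).card ≤ n)
    (hline : ∀ S ⊆ P, Set.InjOn Prod.fst (S : Set (ℝ × ℝ)) → S.card ≤ n)
    (hm : 2 * m + n < P.card) : m ≤ D.card + n := by
  classical
  obtain ⟨u, hu⟩ : ∃ u : ℝ, ∀ x ∈ D, x < u := by
    obtain ⟨M, hM⟩ := D.bddAbove
    exact ⟨M + 1, fun x hx => by linarith [hM hx]⟩
  obtain ⟨d, t, hdt, hDd, -⟩ := exists_seq D u hu
  set k := D.card with hk
  have tmono : ∀ i j, i ≤ j → j ≤ k → t i ≤ t j := by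
    intro i j hij
    induction j, hij using Nat.le_induction with
    | base => intro _; exact le_rfl
    | succ j hj ih =>
      intro h
      have := hdt j (by omega)
      linarith [ih (by omega)]
  have d_lt_t : ∀ i j, i < j → j ≤ k → d i < t j := fun i j hij hj =>
    lt_of_lt_of_le (hdt i (by omega)).2 (tmono _ _ hij hj)
  have t_lt_d : ∀ i j, i ≤ j → j < k → t i < d j := fun i j hij hj =>
    lt_of_le_of_lt (tmono _ _ hij hj.le) (hdt j hj).1
  have d_lt_d : ∀ i j, i < j → j < k → d i < d j := fun i j hij hj =>
    (d_lt_t i j hij hj.le).trans (hdt j hj).1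
  have tD : ∀ i ≤ k, t i ∉ D := by
    intro i hi h
    obtain ⟨j, hj, e⟩ := hDd _ h
    rcases lt_or_ge j i with h' | h'
    · exact (d_lt_t j i h' hi).ne e
    · exact (t_lt_d i j h' hj).ne e.symm
  have uniq : ∀ i < k, ∀ σ ∈ D, t i ≤ σ → σ ≤ t (i+1) → σ = d i := by
    intro i hi σ hσ h1 h2
    obtain ⟨j, hj, rfl⟩ := hDd _ hσ
    rcases lt_trichotomy j i with h | h | h
    · linarith [d_lt_t j i h hi.le]
    · rw [h]
    · linarith [t_lt_d (i+1) j h hj]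
  have inj : ∀ i ≤ k, ∀ p ∈ P, ∀ q ∈ P, p ≠ q → ff (t i) p ≠ ff (t i) q := by
    intro i hi p hp q hq hpq e
    by_cases hx : p.1 = q.1
    · apply hpq
      refine Prod.ext hx ?_
      unfold ff at e; rw [hx] at e; linarith
    · exact tD i hi (sl_eq hx e ▸ hD p hp q hq hx)
  choose L hLP hLc hL' using fun i => exists_lower P (ff (t i)) m (by omega)
  have hL : ∀ i ≤ k, ∀ p ∈ L i, ∀ q ∈ P, q ∉ L i → ff (t i) p < ff (t i) q := by
    intro i hi p hp q hq hqL
    refine lt_of_le_of_ne (hL' i p hp q hq hqL) (inj i hi p (hLP i hp) q hq ?_)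
    rintro rfl; exact hqL hp
  -- crossing
  have hcr : ∀ i < k, ∀ p ∈ L i \ L (i+1), ∀ q ∈ L (i+1) \ L i, ff (d i) p = ff (d i) q := by
    intro i hi p hp q hq
    rw [Finset.mem_sdiff] at hp hq
    have hpP := hLP _ hp.1
    have hqP := hLP _ hq.1
    have h1 := hL i hi.le p hp.1 q hqP hq.2
    have h2 := hL (i+1) hi q hq.1 p hpP hp.2
    have hlt : t i < t (i+1) := (hdt i hi).1.trans (hdt i hi).2
    obtain ⟨hx, h3, h4⟩ := cross1 hlt h1 h2.le
    have := uniq i hi _ (hD p hpP q hqP hx.ne') h3.le h4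
    rw [← this]
    exact sl_spec hx.ne'
  have hcard : ∀ i j, (L i \ L j).card = (L j \ L i).card := by
    intro i j
    exact Finset.card_sdiff_comm ((hLc i).trans (hLc j).symm)
  have hne : ∀ i j, L i ≠ L j → (L i \ L j).Nonempty := by
    intro i j h
    rw [Finset.sdiff_nonempty]
    intro hs
    exact h (Finset.eq_of_subset_of_card_le hs (by rw [hLc, hLc]))
  have hconst : ∀ i < k, ∀ p ∈ L i \ L (i+1), ∀ q ∈ L i \ L (i+1), ff (d i) p = ff (d i) q := by
    intro i hi p hp q hq
    have : (L (i+1) \ L i).Nonempty := by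
      rw [← Finset.card_pos, hcard, Finset.card_pos]; exact ⟨p, hp⟩
    obtain ⟨o, ho⟩ := this
    rw [hcr i hi p hp o ho, hcr i hi q hq o ho]
  have hconst' : ∀ i < k, ∀ p ∈ L (i+1) \ L i, ∀ q ∈ L (i+1) \ L i, ff (d i) p = ff (d i) q := by
    intro i hi p hp q hq
    have : (L i \ L (i+1)).Nonempty := by
      rw [← Finset.card_pos, hcard, Finset.card_pos]; exact ⟨p, hp⟩
    obtain ⟨o, ho⟩ := this
    rw [← hcr i hi o ho p hp, ← hcr i hi o ho q hq]
  have hr : ∀ i < k, (L i \ L (i+1)).card ≤ n := by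
    intro i hi
    apply hline
    · exact Finset.sdiff_subset.trans (hLP i)
    · intro p hp q hq hx
      have := hconst i hi p hp q hq
      unfold ff at this
      rw [hx] at this
      exact Prod.ext hx (by linarith)
  have hcount : ∀ j i, j < i → i < k → ∀ S : Finset ℝ,
      (∀ σ ∈ S, σ ∈ D ∧ d j < σ ∧ σ ≤ d i) → S.card ≤ i - j := by
    intro j i hji hi S hS
    have : S ⊆ (Finset.Ioc j i).image d := by
      intro σ hσ
      obtain ⟨h1, h2, h3⟩ := hS σ hσ
      obtain ⟨l, hl, rfl⟩ := hDd _ h1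
      refine Finset.mem_image.2 ⟨l, Finset.mem_Ioc.2 ⟨?_, ?_⟩, rfl⟩
      · by_contra h
        rcases Nat.lt_or_eq_of_le (not_lt.1 h) with h | h
        · linarith [d_lt_d l j h (by omega)]
        · rw [h] at h2; exact lt_irrefl _ h2
      · by_contra h
        linarith [d_lt_d i l (by omega) hl]
    calc S.card ≤ _ := Finset.card_le_card this
      _ ≤ _ := Finset.card_image_le
      _ = i - j := by simp
  have key : ∀ j i, j < i → i < k → L (j+1) = L i → L j ≠ L (j+1) → L i ≠ L (i+1) →
      (L j \ L (j+1)).card ≤ i - j := by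
    intro j i hji hi hLji hj hi'
    have hjk : j < k := by omega
    obtain ⟨o, ho⟩ := hne _ _ hj
    obtain ⟨w, hw⟩ := hne _ _ hj.symm
    obtain ⟨p, hp⟩ := hne _ _ hi'
    obtain ⟨q, hq⟩ := hne _ _ hi'.symm
    have hpq := hcr i hi p hp q hq
    have how := hcr j hjk o ho w hw
    rw [Finset.mem_sdiff] at hp hq
    have hpP := hLP _ hp.1
    have hqP := hLP _ hq.1
    have hdji := d_lt_d j i hji hi
    by_cases hpv : ff (d j) p = ff (d j) o
    · by_cases hqv : ff (d j) q = ff (d j) o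
      · exfalso
        have := ff_two hdji.ne (hpv.trans hqv.symm) hpq
        rw [this] at hp
        exact hq.2 hp.1
      · -- use q and the outgoing points
        have hqgt : ff (d j) o < ff (d j) q := by
          by_contra h
          have hlt : ff (d j) q < ff (d j) w := by
            rw [← how]; exact lt_of_le_of_ne (not_lt.1 h) hqv
          have hw' := Finset.mem_sdiff.1 hw
          have h2 := hL (j+1) hjk w hw'.1 q hqP (by rw [hLji]; exact hq.2)
          obtain ⟨hx, h3, h4⟩ := cross1 (hdt j hjk).2 hlt h2.le
          have := uniq j hjk _ (hD q hqP w (hLP _ hw'.1) hx.ne') ((hdt j hjk).1.trans h3).le h4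
          linarith
        have main : ∀ c ∈ L j \ L (j+1), q.1 ≠ c.1 ∧ sl q c ∈ D ∧ d j < sl q c ∧ sl q c ≤ d i := by
          intro c hc
          have hcv := hconst j hjk c hc o ho
          rw [Finset.mem_sdiff] at hc
          have hcP := hLP _ hc.1
          have h1 : ff (d j) c < ff (d j) q := by rw [hcv]; exact hqgt
          have h2 : ff (d i) q ≤ ff (d i) c := by
            by_contra h
            push Not at h
            have h5 := hL i hi.le p hp.1 c hcP (by rw [← hLji]; exact hc.2)
            rw [← hpq] at h
            obtain ⟨hx, h3, h4⟩ := cross2 (hdt i hi).1 h5.le h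
            have := uniq i hi _ (hD p hpP c hcP hx.ne') h3 (h4.trans (hdt i hi).2).le
            linarith
          obtain ⟨hx, h3, h4⟩ := cross1 hdji h1 h2
          rw [sl_symm c q] at h3 h4
          exact ⟨hx.ne, hD q hqP c hcP hx.ne, h3, h4⟩
        rw [← Finset.card_image_of_injOn (f := sl q)]
        · apply hcount j i hji hi
          intro σ hσ
          obtain ⟨c, hc, rfl⟩ := Finset.mem_image.1 hσ
          exact (main c hc).2
        · intro c hc c' hc' e
          refine sl_inj (hconst j hjk c hc c' hc') ?_ (main c hc).1 (main c' hc').1 e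
          rw [hconst j hjk c hc o ho]; exact hqv
    · have hplt : ff (d j) p < ff (d j) o := by
        by_contra h
        have hlt : ff (d j) o < ff (d j) p := lt_of_le_of_ne (not_lt.1 h) (Ne.symm hpv)
        have ho' := Finset.mem_sdiff.1 ho
        have h2 := hL (j+1) hjk p (by rw [hLji]; exact hp.1) o (hLP _ ho'.1) ho'.2
        obtain ⟨hx, h3, h4⟩ := cross1 (hdt j hjk).2 hlt h2.le
        have := uniq j hjk _ (hD o (hLP _ ho'.1) p hpP hx.ne') ((hdt j hjk).1.trans h3).le h4
        linarith
      have main : ∀ c ∈ L (j+1) \ L j, p.1 ≠ c.1 ∧ sl p c ∈ D ∧ d j < sl p c ∧ sl p c ≤ d i := by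
        intro c hc
        have hcv := hcr j hjk o ho c hc
        rw [Finset.mem_sdiff] at hc
        have hcP := hLP _ hc.1
        have h1 : ff (d j) p < ff (d j) c := by rw [← hcv]; exact hplt
        have h2 : ff (d i) c ≤ ff (d i) p := by
          by_contra h
          push Not at h
          have h5 := hL i hi.le c (by rw [← hLji]; exact hc.1) q hqP hq.2
          rw [hpq] at h
          obtain ⟨hx, h3, h4⟩ := cross2 (hdt i hi).1 h5.le h
          have := uniq i hi _ (hD c hcP q hqP hx.ne') h3 (h4.trans (hdt i hi).2).le
          linarith
        obtain ⟨hx, h3, h4⟩ := cross1 hdji h1 h2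
        exact ⟨hx.ne', hD p hpP c hcP hx.ne', h3, h4⟩
      rw [hcard, ← Finset.card_image_of_injOn (f := sl p)]
      · apply hcount j i hji hi
        intro σ hσ
        obtain ⟨c, hc, rfl⟩ := Finset.mem_image.1 hσ
        exact (main c hc).2
      · intro c hc c' hc' e
        refine sl_inj (hconst' j hjk c hc c' hc') ?_ (main c hc).1 (main c' hc').1 e
        rw [← hcr j hjk o ho c hc]; exact hpv
  have htri : ∀ i, (L 0 \ L (i+1)).card ≤ (L 0 \ L i).card + (L i \ L (i+1)).card := by
    intro i
    refine le_trans (Finset.card_le_card ?_) (Finset.card_union_le _ _)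
    intro x hx
    simp only [Finset.mem_sdiff, Finset.mem_union] at hx ⊢
    tauto
  have ind : ∀ i ≤ k, L i = L 0 ∨ ∃ j < i, L j ≠ L (j+1) ∧ L (j+1) = L i ∧
      (L 0 \ L i).card ≤ j + 1 + (L j \ L (j+1)).card := by
    intro i
    induction i with
    | zero => intro _; left; rfl
    | succ i ih =>
      intro hi
      by_cases he : L i = L (i+1)
      · rw [← he]
        rcases ih (by omega) with h | ⟨j, hj, h⟩
        · left; exact h
        · right; exact ⟨j, by omega, h⟩
      · right
        refine ⟨i, by omega, he, rfl, ?_⟩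
        have h0 := htri i
        rcases ih (by omega) with h | ⟨j, hj, h1, h2, h3⟩
        · rw [h, Finset.sdiff_self, Finset.card_empty] at h0
          rw [h] at *
          omega
        · have := key j i hj (by omega) h2 h1 he
          omega
  -- the first and the last lower sets are disjoint
  have hdis : Disjoint (L 0) (L k) := by
    rw [Finset.disjoint_left]
    intro p hp0 hpk
    have hsub : P \ (L 0 ∪ L k) ⊆ P.filter (fun z => z.1 = p.1) := by
      intro q hq
      simp only [Finset.mem_sdiff, Finset.mem_union, not_or] at hq
      obtain ⟨hqP, hq0, hqk⟩ := hq
      refine Finset.mem_filter.2 ⟨hqP, ?_⟩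
      by_contra hx
      have hpP := hLP _ hp0
      have h1 := hL 0 (by omega) p hp0 q hqP hq0
      have h2 := hL k le_rfl p hpk q hqP hqk
      have hs := hD p hpP q hqP (Ne.symm hx)
      have he := sl_spec (Ne.symm hx : p.1 ≠ q.1)
      obtain ⟨l, hl, e⟩ := hDd _ hs
      have h3 := t_lt_d 0 l (by omega) hl
      have h4 := d_lt_t l k hl le_rfl
      rw [e] at h3 h4
      obtain ⟨h5, -, -⟩ := cross1 h3 h1 he.ge
      have := cross1 h4 (lt_of_le_of_ne he.ge ?_) h2.le
      · linarith [this.1]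
      · exfalso
        unfold ff at he h2
        nlinarith [mul_pos (sub_pos.2 h4) (sub_pos.2 h5)]
    have h1 := (Finset.card_le_card hsub).trans (hcol p.1)
    have h2 := Finset.le_card_sdiff (L 0 ∪ L k) P
    have h3 := Finset.card_union_le (L 0) (L k)
    rw [hLc, hLc] at h3
    omega
  have hfin : (L 0 \ L k).card = m := by
    rw [Finset.sdiff_eq_self_of_disjoint hdis, hLc]
  rcases ind k le_rfl with h | ⟨j, hj, -, -, h⟩
  · rw [h, Finset.sdiff_self, Finset.card_empty] at hfin
    omega
  · have := hr j hj
    omega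

theorem stmt6 : ∃ c > (0:ℝ), ∀ A : Finset ℝ, 2 ≤ A.card →
    c * (A.card : ℝ)^2 ≤
      (((((A ×ˢ A) ×ˢ (A ×ˢ A)).filter (fun q => q.1.1 ≠ q.1.2)).image
        (fun q => (q.1.2 * q.2.2 - q.1.1 * q.2.1) / (q.1.1 - q.1.2))).card : ℝ) := by
  refine ⟨1/100, by norm_num, fun A hA => ?_⟩
  set D := ((((A ×ˢ A) ×ˢ (A ×ˢ A)).filter (fun q => q.1.1 ≠ q.1.2)).image
        (fun q => (q.1.2 * q.2.2 - q.1.1 * q.2.1) / (q.1.1 - q.1.2))) with hDdef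
  have hDmem : ∀ a1 ∈ A, ∀ a2 ∈ A, ∀ b1 ∈ A, ∀ b2 ∈ A, a1 ≠ a2 →
      (a2 * b2 - a1 * b1) / (a1 - a2) ∈ D := by
    intro a1 h1 a2 h2 b1 h3 b2 h4 hne
    refine Finset.mem_image.2 ⟨((a1, a2), (b1, b2)), ?_, rfl⟩
    simp [h1, h2, h3, h4, hne]
  have hD1 : 1 ≤ D.card := by
    obtain ⟨a, ha, b, hb, hab⟩ := Finset.one_lt_card.1 hA
    exact Finset.card_pos.2 ⟨_, hDmem a ha b hb a ha a ha hab⟩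
  by_cases hsmall : A.card ≤ 5
  · have h1 : (A.card : ℝ) ≤ 5 := by exact_mod_cast hsmall
    have h2 : (1:ℝ) ≤ D.card := by exact_mod_cast hD1
    have h3 : (0:ℝ) ≤ A.card := by positivity
    nlinarith
  push Not at hsmall
  set B := A.erase 0 with hB
  have hBA : B ⊆ A := Finset.erase_subset _ _
  have hBc : A.card ≤ B.card + 1 := by
    have : A.card - 1 ≤ B.card := Finset.pred_card_le_card_erase (s := A) (a := 0)
    omega
  have hB0 : ∀ a ∈ B, a ≠ 0 := fun a ha => Finset.ne_of_mem_erase ha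
  set P := (B ×ˢ B).image (fun z : ℝ × ℝ => (z.1, z.1 * z.2)) with hP
  have hPc : P.card = B.card * B.card := by
    rw [hP, Finset.card_image_of_injOn, Finset.card_product]
    rintro ⟨a, b⟩ h ⟨a', b'⟩ h' e
    simp only [Finset.coe_product, Set.mem_prod, Finset.mem_coe] at h h'
    simp only [Prod.mk.injEq] at e ⊢
    obtain ⟨rfl, e⟩ := e
    exact ⟨rfl, mul_left_cancel₀ (hB0 _ h.1) e⟩
  have hPm : ∀ p ∈ P, ∃ a ∈ B, ∃ b ∈ B, p = (a, a * b) := by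
    intro p hp
    obtain ⟨z, hz, rfl⟩ := Finset.mem_image.1 hp
    rw [Finset.mem_product] at hz
    exact ⟨z.1, hz.1, z.2, hz.2, rfl⟩
  obtain ⟨m, hm1, hm2⟩ : ∃ m, 2 * m + B.card < B.card * B.card ∧
      B.card * B.card ≤ 2 * m + B.card + 2 := by
    have : B.card + 1 ≤ B.card * B.card := by nlinarith
    exact ⟨(B.card * B.card - B.card - 1) / 2, by omega, by omega⟩
  have hu := ungar P D B.card m ?_ ?_ ?_ (by rw [hPc]; exact hm1)
  · have h1 : (m:ℝ) ≤ D.card + B.card := by exact_mod_cast hu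
    have h2 : (B.card:ℝ) * B.card ≤ 2 * m + B.card + 2 := by exact_mod_cast hm2
    have h3 : (A.card:ℝ) ≤ B.card + 1 := by exact_mod_cast hBc
    have h4 : (5:ℝ) ≤ B.card := by exact_mod_cast (by omega : 5 ≤ B.card)
    have h5 : (0:ℝ) ≤ A.card := by positivity
    nlinarith
  · intro p hp q hq hx
    obtain ⟨a, ha, b, hb, rfl⟩ := hPm p hp
    obtain ⟨a', ha', b', hb', rfl⟩ := hPm q hq
    exact hDmem a (hBA ha) a' (hBA ha') b (hBA hb) b' (hBA hb') hx
  · intro x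
    have : P.filter (fun p => p.1 = x) ⊆ B.image (fun b => (x, x * b)) := by
      intro p hp
      rw [Finset.mem_filter] at hp
      obtain ⟨a, ha, b, hb, rfl⟩ := hPm p hp.1
      obtain ⟨-, rfl⟩ := hp
      exact Finset.mem_image.2 ⟨b, hb, rfl⟩
    exact (Finset.card_le_card this).trans Finset.card_image_le
  · intro S hS hinj
    refine Finset.card_le_card_of_injOn Prod.fst ?_ hinj
    intro p hp
    obtain ⟨a, ha, b, hb, rfl⟩ := hPm p (hS hp)
    exact ha
end

section
/- For any finite set A of nonzero real numbers, |A(A+A+A+A)| ≫ |A|² / log|A|, where A(A+A+A+A) = {a(b+c+d+e) : a,b,c,d,e ∈ A}. -/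
open Finset

lemma pairs_eq {α β : Type*} [DecidableEq α] [DecidableEq β] (S : Finset α) (f : α → β) :
    #{p ∈ S ×ˢ S | f p.1 = f p.2} = ∑ b ∈ S.image f, #{x ∈ S | f x = b} ^ 2 := by
  rw [card_eq_sum_card_fiberwise (f := fun p : α × α => f p.1) (t := S.image f)]
  · refine sum_congr rfl fun b _ => ?_
    rw [sq, ← card_product]
    congr 1
    ext ⟨p, q⟩
    simp only [mem_filter, mem_product]
    grind
  · intro p hp
    simp only [coe_filter, mem_product, Set.mem_ofPred_eq] at hp
    exact mem_coe.2 (mem_image_of_mem f hp.1.1)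

lemma card_cs {α β : Type*} [DecidableEq α] [DecidableEq β] (S : Finset α) (f : α → β) :
    #S ^ 2 ≤ #(S.image f) * #{p ∈ S ×ˢ S | f p.1 = f p.2} := by
  rw [pairs_eq, card_eq_sum_card_image f S]
  exact sq_sum_le_card_mul_sum_sq

lemma card_refine {α β γ : Type*} [DecidableEq α] [DecidableEq β] [DecidableEq γ]
    (S : Finset α) (f : α → β) (g : α → γ) (M : ℕ)
    (h : ∀ b, #((S.filter (fun x => f x = b)).image g) ≤ M) :
    #{p ∈ S ×ˢ S | f p.1 = f p.2} ≤ M * #{p ∈ S ×ˢ S | f p.1 = f p.2 ∧ g p.1 = g p.2} := by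
  rw [pairs_eq, card_eq_sum_card_fiberwise (s := {p ∈ S ×ˢ S | f p.1 = f p.2 ∧ g p.1 = g p.2})
    (f := fun p : α × α => f p.1) (t := S.image f), mul_sum]
  · refine sum_le_sum fun b _ => ?_
    refine (card_cs _ g).trans ?_
    refine Nat.mul_le_mul (h b) (card_le_card ?_)
    rintro ⟨p, q⟩
    simp only [mem_filter, mem_product]
    grind
  · intro p hp
    simp only [coe_filter, mem_product, Set.mem_ofPred_eq] at hp
    exact mem_coe.2 (mem_image_of_mem f hp.1.1)

/-- Blocks: a monotone map with fibres of size at most `D`. -/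
lemma exists_blocks (G : Finset ℝ) (D : ℕ) (hD : 0 < D) :
    ∃ f : ℝ → ℕ, Monotone f ∧ (∀ x ∈ G, f x < #G / D + 1) ∧
      ∀ i, #{x ∈ G | f x = i} ≤ D := by
  have hmono : Monotone (fun x : ℝ => #{y ∈ G | y < x}) := by
    intro x y hxy
    refine card_le_card fun z => ?_
    simp only [mem_filter]
    exact fun h => ⟨h.1, h.2.trans_le hxy⟩
  have hstrict : ∀ x ∈ G, ∀ y, x < y → #{z ∈ G | z < x} < #{z ∈ G | z < y} := by
    intro x hx y hxy
    refine card_lt_card ⟨fun z => ?_, fun h => ?_⟩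
    · simp only [mem_filter]
      exact fun h => ⟨h.1, h.2.trans hxy⟩
    · have := h (show x ∈ _ by simp [hx, hxy])
      simp at this
  refine ⟨fun x => #{y ∈ G | y < x} / D, fun x y h => Nat.div_le_div_right (hmono h), ?_, ?_⟩
  · intro x _
    exact Nat.lt_succ_of_le (Nat.div_le_div_right (card_filter_le _ _))
  · intro i
    have : #{x ∈ G | #{y ∈ G | y < x} / D = i} ≤ #(Finset.Ico (i * D) (i * D + D)) := by
      refine card_le_card_of_injOn (fun x => #{y ∈ G | y < x}) ?_ ?_
      · intro x hx
        simp only [coe_filter, Set.mem_ofPred_eq] at hx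
        simp only [coe_Ico, Set.mem_Ico]
        rw [Nat.div_eq_iff hD] at hx
        omega
      · intro x hx y hy hxy
        simp only [coe_filter, Set.mem_ofPred_eq] at hx hy
        rcases lt_trichotomy x y with h | h | h
        · exact absurd hxy (hstrict x hx.1 y h).ne
        · exact h
        · exact absurd hxy (hstrict y hy.1 x h).ne'
    simpa using this

lemma cells_le (G : Finset ℝ) (f : ℝ → ℕ) (hf : Monotone f) (M : ℕ) (hM : ∀ x ∈ G, f x < M)
    (x : ℝ) (hx : 0 < x) (b : ℝ) :
    #(((G ×ˢ G).filter (fun p => x * p.1 - p.2 = b)).image (fun p => (f p.1, f p.2))) ≤ 2 * M := by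
  have : #(((G ×ˢ G).filter (fun p => x * p.1 - p.2 = b)).image (fun p => (f p.1, f p.2)))
      ≤ #(range (2 * M)) := by
    refine card_le_card_of_injOn (fun c => c.1 + c.2) ?_ ?_
    · intro c hc
      simp only [coe_image, Set.mem_image, coe_filter, mem_product, Set.mem_ofPred_eq] at hc
      obtain ⟨p, ⟨⟨h1, h2⟩, _⟩, rfl⟩ := hc
      have := hM _ h1
      have := hM _ h2
      simp only [coe_range, Set.mem_Iio]
      omega
    · intro c hc d hd hcd
      simp only [coe_image, Set.mem_image, coe_filter, mem_product, Set.mem_ofPred_eq] at hc hd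
      obtain ⟨p, ⟨_, hp⟩, rfl⟩ := hc
      obtain ⟨q, ⟨_, hq⟩, rfl⟩ := hd
      simp only at hcd
      rcases le_total p.1 q.1 with h | h
      · have h2 : p.2 ≤ q.2 := by nlinarith
        have := hf h
        have := hf h2
        ext <;> simp only <;> omega
      · have h2 : q.2 ≤ p.2 := by nlinarith
        have := hf h
        have := hf h2
        ext <;> simp only <;> omega
  simpa using this

/-- Same-cell pairs. -/
lemma cell_pairs (G X : Finset ℝ) (f : ℝ → ℕ) (D : ℕ) (hD : ∀ i, #{x ∈ G | f x = i} ≤ D)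
    :
    ∑ x ∈ X, #{p ∈ (G ×ˢ G) ×ˢ (G ×ˢ G) | x * p.1.1 - p.1.2 = x * p.2.1 - p.2.2 ∧
      (f p.1.1, f p.1.2) = (f p.2.1, f p.2.2)} ≤ #G ^ 2 * #X + #G ^ 2 * D ^ 2 := by
  have key : ∀ p ∈ G ×ˢ G, ∑ x ∈ X, #{q ∈ G ×ˢ G | x * p.1 - p.2 = x * q.1 - q.2 ∧
      (f p.1, f p.2) = (f q.1, f q.2)} ≤ #X + D ^ 2 := by
    intro p hp
    rw [← card_sigma]
    have hsub : (X.sigma fun x => {q ∈ G ×ˢ G | x * p.1 - p.2 = x * q.1 - q.2 ∧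
      (f p.1, f p.2) = (f q.1, f q.2)}).card ≤
      #(X.disjSum ({y ∈ G | f y = f p.1} ×ˢ {y ∈ G | f y = f p.2})) := by
      refine card_le_card_of_injOn
        (fun s => if s.2 = p then Sum.inl s.1 else Sum.inr s.2) ?_ ?_
      · rintro ⟨x, q⟩ hs
        simp only [coe_sigma, Set.mem_sigma_iff, mem_coe, mem_filter, mem_product,
          Prod.mk.injEq] at hs
        simp only [mem_coe]
        split_ifs with h
        · simp [hs.1]
        · simp only [inr_mem_disjSum, mem_product, mem_filter]
          grind
      · rintro ⟨x, q⟩ hs ⟨x', q'⟩ hs' heq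
        simp only [coe_sigma, Set.mem_sigma_iff, mem_coe, mem_filter, mem_product,
          Prod.mk.injEq] at hs hs'
        simp only at heq
        split_ifs at heq with h h' h'
        · simp only [Sum.inl.injEq] at heq
          subst h h' heq
          rfl
        · simp only [Sum.inr.injEq] at heq
          subst heq
          have e1 := hs.2.2.1
          have e2 := hs'.2.2.1
          have h3 : (x - x') * (p.1 - q.1) = 0 := by linarith
          rcases mul_eq_zero.1 h3 with h4 | h4
          · have : x = x' := by linarith
            subst this
            rfl
          · exfalso
            apply h
            have h5 : q.1 = p.1 := by linarith
            have h6 : q.2 = p.2 := by rw [h5] at e1; linarith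
            exact Prod.ext h5 h6
    refine hsub.trans ?_
    rw [card_disjSum, card_product, sq]
    exact Nat.add_le_add_left (Nat.mul_le_mul (hD _) (hD _)) _
  have hx : ∀ x ∈ X, #{p ∈ (G ×ˢ G) ×ˢ (G ×ˢ G) | x * p.1.1 - p.1.2 = x * p.2.1 - p.2.2 ∧
      (f p.1.1, f p.1.2) = (f p.2.1, f p.2.2)} = ∑ p ∈ G ×ˢ G,
      #{q ∈ G ×ˢ G | x * p.1 - p.2 = x * q.1 - q.2 ∧ (f p.1, f p.2) = (f q.1, f q.2)} := by
    intro x _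
    simp only [card_filter]
    rw [sum_product]
  rw [sum_congr rfl hx, sum_comm]
  refine (sum_le_sum key).trans ?_
  rw [sum_const, card_product, smul_eq_mul]
  apply le_of_eq
  ring

lemma incid (G X : Finset ℝ) (hX : ∀ x ∈ X, 0 < x) (hc : #X ≤ #G ^ 2) :
    (∑ x ∈ X, #{p ∈ (G ×ˢ G) ×ˢ (G ×ˢ G) | x * p.1.1 - p.1.2 = x * p.2.1 - p.2.2}) ^ 2
      ≤ 400 * #G ^ 6 * #X := by
  rcases X.eq_empty_or_nonempty with rfl | hne
  · simp
  set D := Nat.sqrt #X with hDdef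
  have hXpos : 0 < #X := hne.card_pos
  have hD : 0 < D := Nat.sqrt_pos.2 hXpos
  have hD1 : D ^ 2 ≤ #X := Nat.sqrt_le' _
  have hD2 : #X < (D + 1) ^ 2 := Nat.lt_succ_sqrt' _
  have hDn : D ≤ #G := by
    by_contra h
    push Not at h
    nlinarith
  obtain ⟨f, hf, hM, hfib⟩ := exists_blocks G D hD
  set M := #G / D + 1 with hMdef
  have hMD : M * D ≤ 2 * #G := by
    have := Nat.div_mul_le_self #G D
    rw [hMdef, add_mul]
    omega
  have h1 : ∑ x ∈ X, #{p ∈ (G ×ˢ G) ×ˢ (G ×ˢ G) | x * p.1.1 - p.1.2 = x * p.2.1 - p.2.2}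
      ≤ (2 * M) * (#G ^ 2 * #X + #G ^ 2 * D ^ 2) := by
    refine le_trans ?_ (Nat.mul_le_mul_left _ (cell_pairs G X f D hfib))
    rw [mul_sum]
    refine sum_le_sum fun x hx => ?_
    exact card_refine (G ×ˢ G) (fun p => x * p.1 - p.2) (fun p => (f p.1, f p.2)) (2 * M)
      (cells_le G f hf M hM x (hX x hx))
  have h2 : (2 * M) * (#G ^ 2 * #X + #G ^ 2 * D ^ 2) ≤ 20 * #G ^ 3 * D := by
    have h3 : #X ≤ 4 * D ^ 2 := by nlinarith
    calc (2 * M) * (#G ^ 2 * #X + #G ^ 2 * D ^ 2)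
        ≤ (2 * M) * (#G ^ 2 * (4 * D ^ 2) + #G ^ 2 * D ^ 2) := by gcongr
      _ = 10 * #G ^ 2 * D * (M * D) := by ring
      _ ≤ 10 * #G ^ 2 * D * (2 * #G) := by gcongr
      _ = 20 * #G ^ 3 * D := by ring
  calc _ ≤ (20 * #G ^ 3 * D) ^ 2 := by gcongr; exact h1.trans h2
    _ = 400 * #G ^ 6 * D ^ 2 := by ring
    _ ≤ _ := by gcongr

lemma harm {ι : Type*} [DecidableEq ι] (f : ι → ℕ) (K : ℝ) (n : ℕ) : ∀ (S : Finset ι), #S = n →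
    (∀ T ⊆ S, ∀ x₀ ∈ T, (∀ x ∈ T, f x₀ ≤ f x) → (#T : ℝ) * (f x₀ : ℝ) ^ 2 ≤ K) →
    ∑ x ∈ S, (f x : ℝ) ^ 2 ≤ K * (harmonic n : ℝ) := by
  induction n with
  | zero =>
    intro S hS _
    rw [card_eq_zero] at hS
    simp [hS]
  | succ n ih =>
    intro S hS h
    have hne : S.Nonempty := by rw [← card_pos]; omega
    obtain ⟨x₀, hx₀, hmin⟩ := exists_min_image S f hne
    have h1 := h S subset_rfl x₀ hx₀ hmin
    have h2 := ih (S.erase x₀) (by rw [card_erase_of_mem hx₀]; omega)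
      (fun T hT => h T (hT.trans (erase_subset _ _)))
    rw [← add_sum_erase S _ hx₀, harmonic_succ]
    push_cast
    rw [hS] at h1
    push_cast at h1
    have h3 : (f x₀ : ℝ) ^ 2 ≤ K * ((n : ℝ) + 1)⁻¹ := by
      rw [← div_eq_mul_inv, le_div_iff₀ (by positivity)]
      linarith
    linarith

/-- The argument of Solymosi. -/
lemma solymosi_aux (A B : Finset ℝ) (hA : ∀ x ∈ A, 0 < x) (hBp : ∀ x ∈ B, 0 < x)
    (hB : ∀ x ∈ A, ∀ y ∈ A, x + y ∈ B)
    (t : ℕ) (T : Finset ℝ) : (∀ x ∈ T, t ≤ #{p ∈ A ×ˢ A | p.1 / p.2 = x}) →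
    ∀ m, (∀ x ∈ T, x ≤ m) → #T * t ^ 2 ≤ #{s ∈ B ×ˢ B | s.1 ≤ m * s.2} + t ^ 2 := by
  induction T using Finset.induction_on_max with
  | empty => simp
  | insert a T hmax ih =>
    intro hT m hm
    have haT : a ∉ T := fun h => lt_irrefl _ (hmax a h)
    rw [card_insert_of_notMem haT]
    rcases T.eq_empty_or_nonempty with rfl | hne
    · simp
    set μ := T.max' hne with hμ
    have hμT : μ ∈ T := T.max'_mem hne
    have hμa : μ < a := hmax _ hμT
    have ham : a ≤ m := hm a (mem_insert_self _ _)
    have h1 := ih (fun x hx => hT x (mem_insert_of_mem hx)) μ (fun x hx => T.le_max' x hx)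
    have hdisj : Disjoint {s ∈ B ×ˢ B | s.1 ≤ μ * s.2}
        {s ∈ B ×ˢ B | μ * s.2 < s.1 ∧ s.1 < a * s.2} := by
      rw [disjoint_filter]
      intro s _ h1 h2
      linarith [h2.1]
    have hsub : {s ∈ B ×ˢ B | s.1 ≤ μ * s.2} ∪
        {s ∈ B ×ˢ B | μ * s.2 < s.1 ∧ s.1 < a * s.2} ⊆
        {s ∈ B ×ˢ B | s.1 ≤ m * s.2} := by
      intro s
      simp only [mem_union, mem_filter, mem_product]
      rintro (⟨h, h'⟩ | ⟨h, h1, h2⟩)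
      · have := hBp _ h.2
        exact ⟨h, by nlinarith⟩
      · have := hBp _ h.2
        exact ⟨h, by nlinarith⟩
    have h2 := card_le_card hsub
    rw [card_union_of_disjoint hdisj] at h2
    have hslope : ∀ x, ∀ p ∈ A ×ˢ A, p.1 / p.2 = x → p.1 = x * p.2 := by
      intro x p hp h
      have := hA _ (mem_product.1 hp).2
      rw [← h]
      field_simp
    have h3 : #({p ∈ A ×ˢ A | p.1 / p.2 = μ} ×ˢ {p ∈ A ×ˢ A | p.1 / p.2 = a}) ≤
        #{s ∈ B ×ˢ B | μ * s.2 < s.1 ∧ s.1 < a * s.2} := by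
      refine card_le_card_of_injOn (fun z => (z.1.1 + z.2.1, z.1.2 + z.2.2)) ?_ ?_
      · rintro ⟨p, q⟩ hz
        simp only [mem_coe, mem_product, mem_filter] at hz
        obtain ⟨⟨hp, hp'⟩, hq, hq'⟩ := hz
        have e1 := hslope _ _ (mem_product.2 hp) hp'
        have e2 := hslope _ _ (mem_product.2 hq) hq'
        have p1 := hA _ hp.2
        have p2 := hA _ hq.2
        simp only [mem_coe, mem_filter, mem_product]
        refine ⟨⟨hB _ hp.1 _ hq.1, hB _ hp.2 _ hq.2⟩, ?_, ?_⟩ <;> nlinarith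
      · rintro ⟨p, q⟩ hz ⟨p', q'⟩ hz' heq
        simp only [mem_coe, mem_product, mem_filter] at hz hz'
        obtain ⟨⟨hp, hp'⟩, hq, hq'⟩ := hz
        obtain ⟨⟨hr, hr'⟩, hs, hs'⟩ := hz'
        have e1 := hslope _ _ (mem_product.2 hp) hp'
        have e2 := hslope _ _ (mem_product.2 hq) hq'
        have e3 := hslope _ _ (mem_product.2 hr) hr'
        have e4 := hslope _ _ (mem_product.2 hs) hs'
        simp only [Prod.mk.injEq] at heq
        obtain ⟨k1, k2⟩ := heq
        have k3 : (a - μ) * (q.2 - q'.2) = 0 := by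
          rw [e1, e2, e3, e4] at k1
          linear_combination k1 - μ * k2
        have k4 : q.2 = q'.2 := by
          rcases mul_eq_zero.1 k3 with h | h <;> linarith
        have k5 : p.2 = p'.2 := by linarith
        have k6 : q.1 = q'.1 := by rw [e2, e4, k4]
        have k7 : p.1 = p'.1 := by rw [e1, e3, k5]
        exact Prod.ext (Prod.ext k7 k5) (Prod.ext k6 k4)
    rw [card_product] at h3
    have h4 : t * t ≤ _ := (Nat.mul_le_mul (hT μ (mem_insert_of_mem hμT))
      (hT a (mem_insert_self _ _))).trans h3
    have h5 : t ^ 2 = t * t := sq t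
    rw [add_mul, one_mul]
    omega

lemma rep_le (A : Finset ℝ) (hA : ∀ x ∈ A, 0 < x) (x : ℝ) :
    #{p ∈ A ×ˢ A | p.1 / p.2 = x} ≤ #A := by
  refine card_le_card_of_injOn (fun p => p.2) ?_ ?_
  · intro p hp
    simp only [mem_coe, mem_filter, mem_product] at hp
    exact hp.1.2
  · intro p hp q hq h
    simp only [mem_coe, mem_filter, mem_product] at hp hq
    have h1 := hA _ hp.1.2
    have h2 := hA _ hq.1.2
    simp only at h
    have e : p.1 / p.2 = q.1 / q.2 := hp.2.trans hq.2.symm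
    rw [h] at e
    exact Prod.ext ((div_left_inj' h2.ne').1 e) h

lemma solymosi (A B : Finset ℝ) (hA : ∀ x ∈ A, 0 < x) (hBp : ∀ x ∈ B, 0 < x)
    (hB : ∀ x ∈ A, ∀ y ∈ A, x + y ∈ B) (hAB : #A ≤ #B)
    (t : ℕ) (T : Finset ℝ) (hT : ∀ x ∈ T, t ≤ #{p ∈ A ×ˢ A | p.1 / p.2 = x}) :
    #T * t ^ 2 ≤ 2 * #B ^ 2 := by
  rcases T.eq_empty_or_nonempty with rfl | hne
  · simp
  have h1 := solymosi_aux A B hA hBp hB t T hT (T.max' hne) (fun x hx => T.le_max' x hx)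
  have h2 : #{s ∈ B ×ˢ B | s.1 ≤ T.max' hne * s.2} ≤ #B ^ 2 := by
    refine (card_filter_le _ _).trans ?_
    rw [card_product, sq]
  obtain ⟨x, hx⟩ := hne
  have h3 : t ^ 2 ≤ #B ^ 2 := Nat.pow_le_pow_left ((hT x hx).trans ((rep_le A hA x).trans hAB)) 2
  omega

/-- Counting the solutions via collinear pairs. -/
lemma sol_le (B : Finset ℝ) (x : ℝ) :
    #{p ∈ (B ×ˢ B) ×ˢ (B ×ˢ B) | x * (p.1.1 + p.1.2) = p.2.1 + p.2.2} ≤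
    #{p ∈ ((B ∪ B.image (fun y => -y)) ×ˢ (B ∪ B.image (fun y => -y))) ×ˢ
      ((B ∪ B.image (fun y => -y)) ×ˢ (B ∪ B.image (fun y => -y))) |
      x * p.1.1 - p.1.2 = x * p.2.1 - p.2.2} := by
  refine card_le_card_of_injOn (fun p => ((p.1.1, p.2.1), (-p.1.2, -p.2.2))) ?_ ?_
  · intro p hp
    simp only [mem_coe, mem_filter, mem_product] at hp
    simp only [mem_coe, mem_filter, mem_product, mem_union, mem_image]
    obtain ⟨⟨⟨h1, h2⟩, h3, h4⟩, h5⟩ := hp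
    exact ⟨⟨⟨Or.inl h1, Or.inl h3⟩, Or.inr ⟨_, h2, rfl⟩, Or.inr ⟨_, h4, rfl⟩⟩, by linarith⟩
  · rintro ⟨⟨a, b⟩, c, d⟩ _ ⟨⟨a', b'⟩, c', d'⟩ _ h
    simp only [Prod.mk.injEq, neg_inj] at h
    grind

lemma incid' (B X : Finset ℝ) (hX : ∀ x ∈ X, 0 < x) (hc : #X ≤ #B ^ 2) :
    (∑ x ∈ X, #{p ∈ (B ×ˢ B) ×ˢ (B ×ˢ B) | x * (p.1.1 + p.1.2) = p.2.1 + p.2.2}) ^ 2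
      ≤ 25600 * #B ^ 6 * #X := by
  set G := B ∪ B.image (fun y => -y) with hG
  have hG1 : #B ≤ #G := card_le_card subset_union_left
  have hG2 : #G ≤ 2 * #B := by
    have h1 : #G ≤ #B + #(B.image (fun y => -y)) := card_union_le B (B.image (fun y => -y))
    have h2 := card_image_le (s := B) (f := fun y => -y)
    omega
  have h := incid G X hX (hc.trans (Nat.pow_le_pow_left hG1 2))
  calc _ ≤ (∑ x ∈ X, #{p ∈ (G ×ˢ G) ×ˢ (G ×ˢ G) |
        x * p.1.1 - p.1.2 = x * p.2.1 - p.2.2}) ^ 2 := by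
        refine Nat.pow_le_pow_left (sum_le_sum fun x _ => sol_le B x) 2
    _ ≤ 400 * #G ^ 6 * #X := h
    _ ≤ 400 * (2 * #B) ^ 6 * #X := by gcongr
    _ = _ := by ring

lemma energy_eq (A B : Finset ℝ) (hA : ∀ x ∈ A, 0 < x) :
    #{p ∈ (A ×ˢ (B ×ˢ B)) ×ˢ (A ×ˢ (B ×ˢ B)) |
      p.1.1 * (p.1.2.1 + p.1.2.2) = p.2.1 * (p.2.2.1 + p.2.2.2)} ≤
    ∑ x ∈ (A ×ˢ A).image (fun p => p.1 / p.2), #{p ∈ A ×ˢ A | p.1 / p.2 = x} *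
      #{p ∈ (B ×ˢ B) ×ˢ (B ×ˢ B) | x * (p.1.1 + p.1.2) = p.2.1 + p.2.2} := by
  have h := sum_comp (s := A ×ˢ A)
    (fun x : ℝ => #{p ∈ (B ×ˢ B) ×ˢ (B ×ˢ B) | x * (p.1.1 + p.1.2) = p.2.1 + p.2.2})
    (fun p : ℝ × ℝ => p.1 / p.2)
  simp only [smul_eq_mul] at h
  rw [← h, ← card_sigma]
  refine card_le_card_of_injOn (fun p => ⟨(p.1.1, p.2.1), (p.1.2, p.2.2)⟩) ?_ ?_
  · rintro ⟨⟨a, b, c⟩, a', b', c'⟩ hp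
    simp only [mem_coe, mem_filter, mem_product] at hp
    simp only [mem_coe, mem_sigma, mem_filter, mem_product]
    obtain ⟨⟨⟨h1, h2, h3⟩, h4, h5, h6⟩, h7⟩ := hp
    refine ⟨⟨h1, h4⟩, ⟨⟨h2, h3⟩, h5, h6⟩, ?_⟩
    have := hA _ h4
    field_simp
    linarith
  · rintro ⟨⟨a, b, c⟩, a', b', c'⟩ _ ⟨⟨a1, b1, c1⟩, a1', b1', c1'⟩ _ h
    simp only [Sigma.mk.injEq, Prod.mk.injEq, heq_eq_eq] at h
    grind

lemma num_aux (u v b H : ℝ) (hv : 0 ≤ v) (hH : 0 ≤ H) (h1 : u ≤ 2 * b ^ 2 * H)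
    (h2 : v ≤ 25600 * b ^ 6 * H) : u * v ≤ (227 * b ^ 4 * H) ^ 2 := by
  calc u * v ≤ ((2 * b ^ 2) * H) * ((25600 * b ^ 6) * H) :=
        mul_le_mul h1 h2 hv (by positivity)
    _ = 51200 * ((b ^ 4 * H) ^ 2) := by ring
    _ ≤ 51529 * ((b ^ 4 * H) ^ 2) := by nlinarith [sq_nonneg (b ^ 4 * H)]
    _ = _ := by ring

lemma main_pos (A B P : Finset ℝ) (hA : ∀ x ∈ A, 0 < x) (hne : A.Nonempty)
    (hBp : ∀ x ∈ B, 0 < x) (hB : ∀ x ∈ A, ∀ y ∈ A, x + y ∈ B)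
    (hP : ∀ a ∈ A, ∀ b ∈ B, ∀ c ∈ B, a * (b + c) ∈ P) :
    (#A : ℝ) ^ 2 ≤ 227 * #P * (1 + 2 * Real.log #A) := by
  have hAB : #A ≤ #B := by
    obtain ⟨a, ha⟩ := hne
    refine card_le_card_of_injOn (fun x => x + a) (fun x hx => hB x hx a ha) ?_
    intro x _ y _ h
    simpa using h
  have hApos : 0 < #A := hne.card_pos
  have hBpos : 0 < #B := hApos.trans_le hAB
  set X := (A ×ˢ A).image (fun p => p.1 / p.2) with hXdef
  set r : ℝ → ℕ := fun x => #{p ∈ A ×ˢ A | p.1 / p.2 = x} with hr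
  set N : ℝ → ℕ := fun x =>
    #{p ∈ (B ×ˢ B) ×ˢ (B ×ˢ B) | x * (p.1.1 + p.1.2) = p.2.1 + p.2.2} with hN
  have hXpos : ∀ x ∈ X, 0 < x := by
    intro x hx
    simp only [hXdef, mem_image, mem_product] at hx
    obtain ⟨p, hp, rfl⟩ := hx
    exact div_pos (hA _ hp.1) (hA _ hp.2)
  have hXA : #X ≤ #A ^ 2 := by
    refine card_image_le.trans ?_
    rw [card_product, sq]
  have hXne : 0 < #X := card_pos.2 ((hne.product hne).image _)
  have hr2 : ∑ x ∈ X, (r x : ℝ) ^ 2 ≤ (2 * (#B : ℝ) ^ 2) * (harmonic #X : ℝ) := by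
    refine harm r _ _ X rfl fun T hT x₀ hx₀ hmin => ?_
    exact_mod_cast solymosi A B hA hBp hB hAB (r x₀) T hmin
  have hN2 : ∑ x ∈ X, (N x : ℝ) ^ 2 ≤ (25600 * (#B : ℝ) ^ 6) * (harmonic #X : ℝ) := by
    refine harm N _ _ X rfl fun T hT x₀ hx₀ hmin => ?_
    have h1 := incid' B T (fun x hx => hXpos x (hT hx))
      ((card_le_card hT).trans (hXA.trans (Nat.pow_le_pow_left hAB 2)))
    have h2 : #T * N x₀ ≤ ∑ x ∈ T, N x := by
      rw [← smul_eq_mul]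
      exact card_nsmul_le_sum T N _ hmin
    have h3 : (#T * N x₀) ^ 2 ≤ 25600 * #B ^ 6 * #T := (Nat.pow_le_pow_left h2 2).trans h1
    have hTpos : 0 < #T := card_pos.2 ⟨x₀, hx₀⟩
    have h4 : #T * N x₀ ^ 2 ≤ 25600 * #B ^ 6 := by
      refine Nat.le_of_mul_le_mul_right ?_ hTpos
      calc _ = (#T * N x₀) ^ 2 := by ring
        _ ≤ _ := h3
    exact_mod_cast h4
  set H : ℝ := (harmonic #X : ℝ) with hH
  have hHlog : H ≤ 1 + 2 * Real.log #A := by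
    refine (harmonic_le_one_add_log _).trans ?_
    have : Real.log #X ≤ Real.log ((#A : ℝ) ^ 2) := by
      apply Real.log_le_log
      · exact_mod_cast hXne
      · exact_mod_cast hXA
    rw [Real.log_pow] at this
    push_cast at this
    linarith
  have hH0 : 0 ≤ H := by
    have := harmonic_pos hXne.ne'
    rw [hH]
    exact_mod_cast this.le
  have hcs : (∑ x ∈ X, (r x : ℝ) * N x) ^ 2 ≤ (227 * (#B : ℝ) ^ 4 * H) ^ 2 := by
    exact (sum_mul_sq_le_sq_mul_sq X _ _).trans (num_aux _ _ _ _ (sum_nonneg fun _ _ => sq_nonneg _)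
      hH0 hr2 hN2)
  have hcs' : ∑ x ∈ X, (r x : ℝ) * N x ≤ 227 * (#B : ℝ) ^ 4 * H :=
    
    le_of_sq_le_sq hcs (mul_nonneg (by positivity) hH0)
  have h1 := card_cs (A ×ˢ (B ×ˢ B)) (fun q => q.1 * (q.2.1 + q.2.2))
  have h2 := energy_eq A B hA
  have h3 : #((A ×ˢ (B ×ˢ B)).image (fun q => q.1 * (q.2.1 + q.2.2))) ≤ #P := by
    refine card_le_card fun z hz => ?_
    simp only [mem_image, mem_product] at hz
    obtain ⟨q, hq, rfl⟩ := hz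
    exact hP _ hq.1 _ hq.2.1 _ hq.2.2
  have h4 : (#A * (#B * #B)) ^ 2 ≤ #P * ∑ x ∈ X, r x * N x := by
    rw [card_product, card_product] at h1
    exact h1.trans (Nat.mul_le_mul h3 h2)
  have h5 : ((#A : ℝ) * (#B * #B)) ^ 2 ≤ #P * ∑ x ∈ X, (r x : ℝ) * N x := by
    exact_mod_cast h4
  have hB0 : (0 : ℝ) < (#B : ℝ) ^ 4 := by positivity
  refine le_of_mul_le_mul_right ?_ hB0
  calc (#A : ℝ) ^ 2 * (#B : ℝ) ^ 4 = ((#A : ℝ) * (#B * #B)) ^ 2 := by ring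
    _ ≤ #P * ∑ x ∈ X, (r x : ℝ) * N x := h5
    _ ≤ #P * (227 * (#B : ℝ) ^ 4 * H) := by gcongr
    _ ≤ #P * (227 * (#B : ℝ) ^ 4 * (1 + 2 * Real.log #A)) := by gcongr
    _ = _ := by ring

lemma main_signed (A A' P : Finset ℝ) (ε : ℝ) (hε : ε * ε = 1) (hA' : ∀ x ∈ A', 0 < x)
    (hsub : ∀ x ∈ A', ε * x ∈ A) (hcard : #A ≤ 2 * #A') (h2 : 2 ≤ #A)
    (hle : #A' ≤ #A)
    (hP : ∀ a ∈ A, ∀ b ∈ A, ∀ c ∈ A, ∀ d ∈ A, ∀ e ∈ A, a * (b + c + d + e) ∈ P) :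
    (1 / 2724 : ℝ) * ((#A : ℝ) ^ 2 / Real.logb 2 #A) ≤ #P := by
  have hpos : 0 < #A' := by omega
  have h := main_pos A' ((A' ×ˢ A').image (fun p => p.1 + p.2)) P hA' (card_pos.1 hpos) ?_ ?_ ?_
  · have hA2 : (2 : ℝ) ≤ #A := by exact_mod_cast h2
    have hlogA : Real.log #A' ≤ Real.log #A := by
      apply Real.log_le_log
      · exact_mod_cast hpos
      · exact_mod_cast hle
    have hl1 : 1 ≤ Real.logb 2 #A := by
      rw [Real.le_logb_iff_rpow_le (by norm_num) (by linarith)]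
      simpa using hA2
    have hl2 : Real.log #A ≤ Real.logb 2 #A := by
      have hlog2 : 0 < Real.log 2 := Real.log_pos (by norm_num)
      have hlog2' : Real.log 2 ≤ 1 := by linarith [Real.log_two_lt_d9]
      rw [Real.logb, le_div_iff₀ hlog2]
      have : 0 ≤ Real.log #A := Real.log_nonneg (by linarith)
      nlinarith
    have hc : (#A : ℝ) ≤ 2 * #A' := by exact_mod_cast hcard
    have h3 : (#A : ℝ) ^ 2 ≤ 2724 * #P * Real.logb 2 #A := by
      calc (#A : ℝ) ^ 2 ≤ (2 * #A') ^ 2 := by gcongr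
        _ = 4 * (#A' : ℝ) ^ 2 := by ring
        _ ≤ 4 * (227 * #P * (1 + 2 * Real.log #A')) := by gcongr
        _ ≤ 4 * (227 * #P * (3 * Real.logb 2 #A)) := by gcongr; linarith
        _ = _ := by ring
    have h4 : (#A : ℝ) ^ 2 / Real.logb 2 #A ≤ 2724 * #P := by
      rw [div_le_iff₀ (by linarith)]
      exact h3
    linarith
  · intro x hx
    simp only [mem_image, mem_product] at hx
    obtain ⟨p, hp, rfl⟩ := hx
    exact add_pos (hA' _ hp.1) (hA' _ hp.2)
  · intro x hx y hy
    exact mem_image.2 ⟨(x, y), mem_product.2 ⟨hx, hy⟩, rfl⟩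
  · intro a ha b hb c hc
    simp only [mem_image, mem_product] at hb hc
    obtain ⟨p, hp, rfl⟩ := hb
    obtain ⟨q, hq, rfl⟩ := hc
    have := hP _ (hsub a ha) _ (hsub _ hp.1) _ (hsub _ hp.2) _ (hsub _ hq.1) _ (hsub _ hq.2)
    convert this using 1
    linear_combination (-(a * (p.1 + p.2 + (q.1 + q.2)))) * hε

theorem stmt12 : ∃ c > (0:ℝ), ∀ A : Finset ℝ, (0:ℝ) ∉ A → 2 ≤ A.card →
    c * ((A.card : ℝ)^2 / Real.logb 2 (A.card : ℝ)) ≤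
      (((A ×ˢ A ×ˢ A ×ˢ A ×ˢ A).image
        (fun q => q.1 * (q.2.1 + q.2.2.1 + q.2.2.2.1 + q.2.2.2.2))).card : ℝ) := by
  refine ⟨1 / 2724, by norm_num, fun A h0 h2 => ?_⟩
  have hP : ∀ a ∈ A, ∀ b ∈ A, ∀ c ∈ A, ∀ d ∈ A, ∀ e ∈ A, a * (b + c + d + e) ∈
      (A ×ˢ A ×ˢ A ×ˢ A ×ˢ A).image
        (fun q => q.1 * (q.2.1 + q.2.2.1 + q.2.2.2.1 + q.2.2.2.2)) := by
    intro a ha b hb c hc d hd e he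
    refine mem_image.2 ⟨(a, b, c, d, e), ?_, rfl⟩
    simp only [mem_product]
    exact ⟨ha, hb, hc, hd, he⟩
  have hsplit := card_filter_add_card_filter_not (s := A) (fun x => 0 < x)
  rcases le_total #{x ∈ A | 0 < x} #{x ∈ A | ¬ 0 < x} with h | h
  · have hcard : #({x ∈ A | ¬ 0 < x}.image (fun x => -x)) = #{x ∈ A | ¬ 0 < x} :=
      card_image_of_injective _ neg_injective
    refine main_signed A ({x ∈ A | ¬ 0 < x}.image (fun x => -x)) _ (-1) (by norm_num)
      ?_ ?_ (by omega) h2 (by omega) hP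
    · intro x hx
      simp only [mem_image, mem_filter] at hx
      obtain ⟨y, ⟨hy, hy'⟩, rfl⟩ := hx
      have : y ≠ 0 := fun h => h0 (h ▸ hy)
      have := lt_of_le_of_ne (not_lt.1 hy') this
      linarith
    · intro x hx
      simp only [mem_image, mem_filter] at hx
      obtain ⟨y, ⟨hy, hy'⟩, rfl⟩ := hx
      simpa using hy
  · refine main_signed A {x ∈ A | 0 < x} _ 1 (by norm_num)
      ?_ ?_ (by omega) h2 (by omega) hP
    · intro x hx
      exact (mem_filter.1 hx).2
    · intro x hx
      simpa using (mem_filter.1 hx).1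
end

section
/- For any finite set A of nonzero real numbers, there is a subset A' ⊆ A with |A'| ≥ |A|/2 such that for every a ∈ A', |A(A+a)| ≫ |A|^{3/2}, where A(A+a) = {b(c+a) : b, c ∈ A}. -/
open Finset

namespace S13

lemma cs {α β : Type*} [DecidableEq β] (s : Finset α) (f : α → β) :
    s.card ^ 2 ≤ (s.image f).card * ∑ p ∈ s, (s.filter (fun q => f q = f p)).card := by
  have h1 : s.card = ∑ z ∈ s.image f, (s.filter (fun q => f q = z)).card :=
    Finset.card_eq_sum_card_fiberwise (fun x hx => Finset.mem_image_of_mem f hx)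
  have h2 : ∑ p ∈ s, (s.filter (fun q => f q = f p)).card
      = ∑ z ∈ s.image f, (s.filter (fun q => f q = z)).card ^ 2 := by
    rw [← Finset.sum_fiberwise_of_maps_to (g := f) (t := s.image f)
      (fun x hx => Finset.mem_image_of_mem f hx)]
    refine Finset.sum_congr rfl fun z _ => ?_
    rw [Finset.sum_congr rfl (g := fun _ => (s.filter (fun q => f q = z)).card)]
    · rw [Finset.sum_const, smul_eq_mul, sq]
    · intro x hx
      rw [(Finset.mem_filter.1 hx).2]
  rw [h2, h1]
  exact sq_sum_le_card_mul_sum_sq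

/-- rank of a real in a finite set -/
noncomputable def rk (A : Finset ℝ) (x : ℝ) : ℕ := (A.filter (fun z => z < x)).card

lemma rk_mono (A : Finset ℝ) {x y : ℝ} (h : x ≤ y) : rk A x ≤ rk A y := by
  apply Finset.card_le_card
  intro z hz
  rw [Finset.mem_filter] at *
  exact ⟨hz.1, hz.2.trans_le h⟩

lemma rk_strict (A : Finset ℝ) {x y : ℝ} (hx : x ∈ A) (h : x < y) : rk A x < rk A y := by
  apply Finset.card_lt_card
  rw [Finset.ssubset_iff_of_subset]
  · exact ⟨x, by simp [hx, h], by simp⟩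
  · intro z hz
    rw [Finset.mem_filter] at *
    exact ⟨hz.1, hz.2.trans h⟩

lemma rk_inj (A : Finset ℝ) {x y : ℝ} (hx : x ∈ A) (hy : y ∈ A) (h : rk A x = rk A y) : x = y := by
  rcases lt_trichotomy x y with h1 | h1 | h1
  · have := rk_strict A hx h1; omega
  · exact h1
  · have := rk_strict A hy h1; omega

lemma rk_lt (A : Finset ℝ) {x : ℝ} (hx : x ∈ A) : rk A x < A.card := by
  apply Finset.card_lt_card
  rw [Finset.ssubset_iff_of_subset (Finset.filter_subset _ _)]
  exact ⟨x, hx, by simp⟩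

lemma cell_card (A : Finset ℝ) (m : ℕ) (hm : 0 < m) (i : ℕ) :
    (A.filter (fun x => rk A x / m = i)).card ≤ m := by
  have : (A.filter (fun x => rk A x / m = i)).card ≤ (Finset.Ico (i*m) (i*m+m)).card := by
    apply Finset.card_le_card_of_injOn (rk A)
    · intro x hx
      have hx := (Finset.mem_filter.1 (Finset.mem_coe.1 hx)).2
      simp only [Finset.coe_Ico, Set.mem_Ico]
      have h1 := Nat.div_add_mod (rk A x) m
      have h2 := Nat.mod_lt (rk A x) hm
      rw [hx] at h1
      rw [mul_comm m i] at h1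
      constructor <;> omega
    · intro x hx y hy h
      exact rk_inj A (Finset.mem_filter.1 (Finset.mem_coe.1 hx)).1
        (Finset.mem_filter.1 (Finset.mem_coe.1 hy)).1 h
  simpa using this

/-- the cell of a point -/
noncomputable def cell (A : Finset ℝ) (m : ℕ) (p : ℝ × ℝ) : ℕ × ℕ :=
  (rk (A.image (fun x => x⁻¹)) p.1⁻¹ / m, rk A p.2 / m)

lemma cell_pair_card (A : Finset ℝ) (m : ℕ) (hm : 0 < m) (w : ℕ × ℕ) :
    ((A ×ˢ A).filter (fun q => cell A m q = w)).card ≤ m * m := by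
  set B := A.image (fun x : ℝ => x⁻¹) with hB
  have : ((A ×ˢ A).filter (fun q => cell A m q = w)).card ≤
      ((B.filter (fun x => rk B x / m = w.1)) ×ˢ (A.filter (fun x => rk A x / m = w.2))).card := by
    apply Finset.card_le_card_of_injOn (fun p => (p.1⁻¹, p.2))
    · intro p hp
      have hp := Finset.mem_filter.1 (Finset.mem_coe.1 hp)
      obtain ⟨hp1, hp2⟩ := hp
      rw [Finset.mem_product] at hp1
      subst hp2
      simp only [Finset.mem_coe, Finset.mem_product, Finset.mem_filter]
      exact ⟨⟨Finset.mem_image_of_mem _ hp1.1, rfl⟩, hp1.2, rfl⟩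
    · rintro ⟨x, y⟩ _ ⟨x', y'⟩ _ h
      simpa using h
  refine this.trans ?_
  rw [Finset.card_product]
  exact Nat.mul_le_mul (cell_card B m hm _) (cell_card A m hm _)

lemma image_card (A : Finset ℝ) (h0 : (0:ℝ) ∉ A) (m : ℕ) (hm : A.card < m * m) (a : ℝ) :
    ((A ×ˢ A).image (fun p => (p.1 * (p.2 + a), cell A m p))).card ≤
      ((A ×ˢ A).image (fun p => p.1 * (p.2 + a))).card * (2 * m) := by
  set B := A.image (fun x : ℝ => x⁻¹) with hB
  have hcell : ∀ p ∈ A ×ˢ A, (cell A m p).1 < m ∧ (cell A m p).2 < m := by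
    intro p hp
    rw [Finset.mem_product] at hp
    constructor
    · apply Nat.div_lt_of_lt_mul
      have h1 : rk B p.1⁻¹ < B.card := rk_lt B (Finset.mem_image_of_mem _ hp.1)
      have h2 : B.card ≤ A.card := Finset.card_image_le
      change rk B p.1⁻¹ < m * m
      omega
    · apply Nat.div_lt_of_lt_mul
      have h1 := rk_lt A hp.2
      omega
  rw [← Finset.card_range (2 * m), ← Finset.card_product]
  apply Finset.card_le_card_of_injOn
    (fun z : ℝ × (ℕ × ℕ) => (z.1, if 0 ≤ z.1 then z.2.1 + z.2.2 else z.2.1 + (m - 1 - z.2.2)))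
  · intro z hz
    obtain ⟨p, hp, rfl⟩ := Finset.mem_image.1 (Finset.mem_coe.1 hz)
    have := hcell p hp
    simp only [Finset.mem_coe, Finset.mem_product, Finset.mem_range]
    refine ⟨Finset.mem_image_of_mem _ hp, ?_⟩
    split_ifs <;> omega
  · intro z hz z' hz' h
    obtain ⟨p, hp, rfl⟩ := Finset.mem_image.1 (Finset.mem_coe.1 hz)
    obtain ⟨q, hq, rfl⟩ := Finset.mem_image.1 (Finset.mem_coe.1 hz')
    have hcp := hcell p hp
    have hcq := hcell q hq
    simp only [Prod.mk.injEq] at h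
    obtain ⟨hy, hs⟩ := h
    rw [← hy] at hs
    have key : ∀ p ∈ A ×ˢ A, p.2 = p.1 * (p.2 + a) * p.1⁻¹ - a := by
      intro p hp
      have : p.1 ≠ 0 := fun h => h0 (h ▸ (Finset.mem_product.1 hp).1)
      field_simp
      ring
    have kp := key p hp
    have kq := key q hq
    rw [← hy] at kq
    set y := p.1 * (p.2 + a) with hyd
    have m1 : ∀ u v : ℝ × ℝ, u.1⁻¹ ≤ v.1⁻¹ → (cell A m u).1 ≤ (cell A m v).1 :=
      fun u v h => Nat.div_le_div_right (rk_mono B h)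
    have m2 : ∀ u v : ℝ × ℝ, u.2 ≤ v.2 → (cell A m u).2 ≤ (cell A m v).2 :=
      fun u v h => Nat.div_le_div_right (rk_mono A h)
    have goal : (cell A m p).1 = (cell A m q).1 ∧ (cell A m p).2 = (cell A m q).2 := by
      by_cases h0y : 0 ≤ y
      · simp only [h0y, if_true] at hs
        rcases le_total p.1⁻¹ q.1⁻¹ with hle | hle
        · have h1 := m1 _ _ hle
          have h2 := m2 p q (by nlinarith [mul_le_mul_of_nonneg_left hle h0y])
          omega
        · have h1 := m1 _ _ hle
          have h2 := m2 q p (by nlinarith [mul_le_mul_of_nonneg_left hle h0y])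
          omega
      · simp only [h0y, if_false] at hs
        push Not at h0y
        rcases le_total p.1⁻¹ q.1⁻¹ with hle | hle
        · have h1 := m1 _ _ hle
          have h2 := m2 q p (by nlinarith [mul_le_mul_of_nonpos_left hle h0y.le])
          omega
        · have h1 := m1 _ _ hle
          have h2 := m2 p q (by nlinarith [mul_le_mul_of_nonpos_left hle h0y.le])
          omega
    exact Prod.ext hy (Prod.ext goal.1 goal.2)

/-- energy -/
noncomputable def En (A : Finset ℝ) (m : ℕ) (a : ℝ) : ℕ :=
  ∑ p ∈ A ×ˢ A, ((A ×ˢ A).filter (fun q =>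
    (q.1 * (q.2 + a), cell A m q) = (p.1 * (p.2 + a), cell A m p))).card

lemma en_sum (A : Finset ℝ) (h0 : (0:ℝ) ∉ A) (m : ℕ) (hm : 0 < m) :
    ∑ a ∈ A, En A m a ≤ A.card * A.card * (A.card + m * m) := by
  unfold En
  rw [Finset.sum_comm]
  have : ∀ p ∈ A ×ˢ A, ∑ a ∈ A, ((A ×ˢ A).filter (fun q =>
      (q.1 * (q.2 + a), cell A m q) = (p.1 * (p.2 + a), cell A m p))).card ≤ A.card + m * m := by
    intro p hp
    simp only [Finset.card_filter]
    rw [Finset.sum_comm]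
    have hb : ∀ q ∈ A ×ˢ A, (∑ a ∈ A, if (q.1 * (q.2 + a), cell A m q) =
        (p.1 * (p.2 + a), cell A m p) then 1 else 0) ≤
        (if q = p then A.card else 0) + (if cell A m q = cell A m p then 1 else 0) := by
      intro q hq
      rw [← Finset.card_filter]
      by_cases hqp : q = p
      · rw [if_pos hqp]
        exact (Finset.card_filter_le _ _).trans (Nat.le_add_right _ _)
      · rw [if_neg hqp, zero_add]
        by_cases hc : cell A m q = cell A m p
        · rw [if_pos hc, Finset.card_le_one]
          intro a ha a' ha'
          have e1 := (Prod.mk.injEq _ _ _ _ ▸ (Finset.mem_filter.1 ha).2).1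
          have e2 := (Prod.mk.injEq _ _ _ _ ▸ (Finset.mem_filter.1 ha').2).1
          have hne : q.1 - p.1 ≠ 0 := by
            intro h
            have h : q.1 = p.1 := by linarith
            have hp0 : p.1 ≠ 0 := fun h => h0 (h ▸ (Finset.mem_product.1 hp).1)
            rw [h] at e1
            have := mul_left_cancel₀ hp0 e1
            exact hqp (Prod.ext h (by linarith))
          apply mul_left_cancel₀ hne
          linarith
        · rw [if_neg hc]
          simp [hc]
    refine (Finset.sum_le_sum hb).trans ?_
    rw [Finset.sum_add_distrib, ← Finset.card_filter, Finset.sum_ite_eq' , if_pos hp]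
    exact Nat.add_le_add_left (cell_pair_card A m hm _) _
  refine (Finset.sum_le_card_nsmul _ _ _ this).trans ?_
  rw [Finset.card_product, smul_eq_mul]

end S13

theorem stmt13 : ∃ c > (0:ℝ), ∀ A : Finset ℝ, (0:ℝ) ∉ A →
    ∃ A' ⊆ A, (A.card : ℝ) / 2 ≤ (A'.card : ℝ) ∧ ∀ a ∈ A',
      c * Real.sqrt ((A.card : ℝ)^3) ≤
        (((A ×ˢ A).image (fun p => p.1 * (p.2 + a))).card : ℝ) := by
  refine ⟨1/40, by norm_num, fun A h0 => ?_⟩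
  rcases A.eq_empty_or_nonempty with rfl | hne
  · exact ⟨∅, by simp, by simp, by simp⟩
  set n := A.card with hn
  have hn0 : 0 < n := hne.card_pos
  set M := Nat.sqrt n with hM
  have hM1 : 1 ≤ M := Nat.sqrt_pos.2 hn0
  have hMn : M * M ≤ n := Nat.sqrt_le n
  have hnM : n < (M + 1) * (M + 1) := Nat.lt_succ_sqrt n
  have hmm : (M + 1) * (M + 1) ≤ 4 * n := by nlinarith
  have hsum := S13.en_sum A h0 (M + 1) (Nat.succ_pos _)
  rw [← hn] at hsum
  refine ⟨A.filter (fun a => S13.En A (M+1) a ≤ 10 * n ^ 2), Finset.filter_subset _ _, ?_, ?_⟩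
  · have hc := Finset.card_filter_add_card_filter_not (s := A)
      (fun a => S13.En A (M+1) a ≤ 10 * n ^ 2)
    set g := (A.filter (fun a => S13.En A (M+1) a ≤ 10 * n ^ 2)).card
    set b := (A.filter (fun a => ¬ S13.En A (M+1) a ≤ 10 * n ^ 2)).card with hb
    have h1 : b * (10 * n ^ 2) ≤ ∑ a ∈ A, S13.En A (M+1) a := by
      calc b * (10 * n ^ 2) ≤ ∑ a ∈ A.filter (fun a => ¬ S13.En A (M+1) a ≤ 10 * n ^ 2),
            S13.En A (M+1) a := by
            rw [hb, ← smul_eq_mul]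
            apply Finset.card_nsmul_le_sum
            intro x hx
            have := (Finset.mem_filter.1 hx).2
            omega
        _ ≤ _ := Finset.sum_le_sum_of_subset (Finset.filter_subset _ _)
    have h2 : b * (10 * n ^ 2) ≤ n * n * (5 * n) :=
      (h1.trans hsum).trans (Nat.mul_le_mul_left _ (by omega))
    have h3 : 2 * b ≤ n := by
      have : (5 * n ^ 2) * (2 * b) ≤ (5 * n ^ 2) * n := by nlinarith
      exact Nat.le_of_mul_le_mul_left this (by positivity)
    have h4 : n ≤ 2 * g := by omega
    have : (n : ℝ) ≤ 2 * g := by exact_mod_cast h4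
    linarith
  · intro a ha
    have hE := (Finset.mem_filter.1 ha).2
    have h1 := S13.cs (A ×ˢ A) (fun p => (p.1 * (p.2 + a), S13.cell A (M+1) p))
    have h2 := S13.image_card A h0 (M+1) hnM a
    set Y := ((A ×ˢ A).image (fun p => p.1 * (p.2 + a))).card
    have h3 : (n * n) ^ 2 ≤ (Y * (2 * (M + 1))) * (10 * n ^ 2) := by
      rw [Finset.card_product] at h1
      exact h1.trans (Nat.mul_le_mul h2 hE)
    have h4 : n ^ 2 ≤ 40 * Y * M := by
      have : n ^ 2 * n ^ 2 ≤ n ^ 2 * (Y * (20 * (M + 1))) := by nlinarith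
      have := Nat.le_of_mul_le_mul_left this (by positivity)
      have h5 : Y * (20 * (M + 1)) ≤ Y * (40 * M) := Nat.mul_le_mul_left _ (by omega)
      nlinarith
    have h4' : (n:ℝ) ^ 2 ≤ 40 * Y * M := by exact_mod_cast h4
    have hMs : (M : ℝ) ≤ Real.sqrt n := Real.nat_sqrt_le_real_sqrt
    have hnr : (0:ℝ) < n := by exact_mod_cast hn0
    have hs : 0 < Real.sqrt n := Real.sqrt_pos.2 hnr
    have hss : Real.sqrt n * Real.sqrt n = n := Real.mul_self_sqrt hnr.le
    have e : Real.sqrt ((n:ℝ)^3) = n * Real.sqrt n := by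
      rw [show (n:ℝ)^3 = (n:ℝ)^2 * n by ring, Real.sqrt_mul (by positivity),
        Real.sqrt_sq hnr.le]
    rw [e]
    have h6 : (n:ℝ) ^ 2 ≤ 40 * Y * Real.sqrt n :=
      h4'.trans (mul_le_mul_of_nonneg_left hMs (by positivity))
    have h7 : (n * Real.sqrt n) * Real.sqrt n ≤ (40 * Y) * Real.sqrt n := by
      rw [mul_assoc, hss]; linarith
    have := le_of_mul_le_mul_right h7 hs
    linarith
end

section
/- Let A, B be finite sets of real numbers with 0 ∉ A. Then |A + B|³ ≫ |B| · E*(A) / log|A| ≥ |A|⁴|B| / (|A·A| · log|A|). -/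
open Finset Pointwise

/-- rank of `x` in `X`. -/
noncomputable def rk (X : Finset ℝ) (x : ℝ) : ℕ := (X.filter (fun y => y < x)).card

lemma rk_lt {X : Finset ℝ} {x y : ℝ} (hx : x ∈ X) (h : x < y) : rk X x < rk X y := by
  unfold rk
  apply Finset.card_lt_card
  rw [Finset.ssubset_iff_of_subset]
  · exact ⟨x, by simp [hx, h], by simp⟩
  · intro z hz
    simp only [Finset.mem_filter] at hz ⊢
    exact ⟨hz.1, hz.2.trans h⟩

lemma rk_le (X : Finset ℝ) (x : ℝ) : rk X x ≤ X.card := Finset.card_filter_le _ _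

lemma rk_inj {X : Finset ℝ} {x y : ℝ} (hx : x ∈ X) (hy : y ∈ X) (h : rk X x = rk X y) : x = y := by
  rcases lt_trichotomy x y with h1 | h1 | h1
  · exact absurd h (rk_lt hx h1).ne
  · exact h1
  · exact absurd h (rk_lt hy h1).ne'

/-- distance of ranks -/
noncomputable def rd (X : Finset ℝ) (x y : ℝ) : ℕ := ((rk X x : ℤ) - (rk X y : ℤ)).natAbs

lemma rd_sum (X : Finset ℝ) (x : ℝ) (hx : x ∈ X) (F : ℕ → ℝ) (hF : ∀ n, 0 ≤ F n) :
    ∑ y ∈ X.filter (fun y => y ≠ x), F (rd X x y) ≤ 2 * ∑ g ∈ Finset.Icc 1 X.card, F g := by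
  have hsplit : X.filter (fun y => y ≠ x) = X.filter (fun y => y < x) ∪ X.filter (fun y => x < y) := by
    ext y
    simp only [Finset.mem_filter, Finset.mem_union, ne_iff_lt_or_gt]
    tauto
  rw [hsplit]
  have hd : Disjoint (X.filter (fun y => y < x)) (X.filter (fun y => x < y)) := by
    rw [Finset.disjoint_filter]
    intro y _ h1 h2
    exact lt_asymm h1 h2
  rw [Finset.sum_union hd, two_mul]
  have key : ∀ S : Finset ℝ, S ⊆ X → Set.InjOn (rd X x) S → x ∉ S →
      ∑ y ∈ S, F (rd X x y) ≤ ∑ g ∈ Finset.Icc 1 X.card, F g := by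
    intro S hS hinj hxS
    rw [← Finset.sum_image (f := F) hinj]
    apply Finset.sum_le_sum_of_subset_of_nonneg
    · intro g hg
      rw [Finset.mem_image] at hg
      obtain ⟨y, hy, rfl⟩ := hg
      have h1 : rk X x ≠ rk X y := fun h => hxS (by rw [rk_inj hx (hS hy) h]; exact hy)
      have h2 := rk_le X x
      have h3 := rk_le X y
      rw [Finset.mem_Icc]
      unfold rd
      omega
    · intros; exact hF _
  apply add_le_add
  · apply key _ (Finset.filter_subset _ _)
    · intro y hy z hz h
      simp only [Finset.coe_filter, Set.mem_ofPred_eq] at hy hz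
      apply rk_inj hy.1 hz.1
      have := rk_lt hy.1 hy.2
      have := rk_lt hz.1 hz.2
      unfold rd at h
      omega
    · simp
  · apply key _ (Finset.filter_subset _ _)
    · intro y hy z hz h
      simp only [Finset.coe_filter, Set.mem_ofPred_eq] at hy hz
      apply rk_inj hy.1 hz.1
      have := rk_lt hx hy.2
      have := rk_lt hx hz.2
      unfold rd at h
      omega
    · simp

lemma sum_inv_sq (g : ℕ) (hg : 1 ≤ g) (N : ℕ) :
    ∑ h ∈ Finset.Icc 1 N, (1:ℝ) / ((g + h : ℕ) : ℝ)^2 ≤ 1 / g := by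
  have hg' : (1:ℝ) ≤ g := by exact_mod_cast hg
  have : ∑ h ∈ Finset.Icc 1 N, (1:ℝ) / ((g + h : ℕ) : ℝ)^2 ≤ 1 / (g:ℝ) - 1 / ((g:ℝ) + N) := by
    induction N with
    | zero => simp
    | succ n ih =>
      rw [Finset.sum_Icc_succ_top (by omega)]
      have hn : (0:ℝ) ≤ n := Nat.cast_nonneg n
      have : (1:ℝ) / ((g + (n+1) : ℕ) : ℝ)^2 ≤ 1 / ((g:ℝ) + n) - 1 / ((g:ℝ) + (n+1 : ℕ)) := by
        push_cast
        rw [div_sub_div _ _ (by positivity) (by positivity), div_le_div_iff₀ (by positivity) (by positivity)]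
        have : (0:ℝ) < g + n := by positivity
        nlinarith
      linarith
  have h2 : (0:ℝ) ≤ 1 / ((g:ℝ) + N) := by positivity
  linarith

lemma sum_inv_sq2 (N : ℕ) :
    ∑ g ∈ Finset.Icc 1 N, ∑ h ∈ Finset.Icc 1 N, (1:ℝ) / ((g + h : ℕ) : ℝ)^2 ≤ 1 + Real.log N := by
  have h1 := harmonic_le_one_add_log N
  rw [harmonic_eq_sum_Icc] at h1
  push_cast at h1
  refine le_trans (Finset.sum_le_sum (fun g hg => sum_inv_sq g (Finset.mem_Icc.1 hg).1 N)) ?_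
  simpa [one_div] using h1

/-- points of the line `y = l x + c` in `X × X` -/
noncomputable def onl (X : Finset ℝ) (l c : ℝ) : Finset ℝ := X.filter (fun x => l * x + c ∈ X)

noncomputable def wt (X : Finset ℝ) (p : (ℝ × ℝ) × (ℝ × ℝ)) : ℝ :=
  1 / ((rd X p.1.1 p.2.1 + rd X p.1.2 p.2.2 : ℕ) : ℝ)^2

noncomputable def quads (X : Finset ℝ) : Finset ((ℝ × ℝ) × (ℝ × ℝ)) :=
  ((X ×ˢ X) ×ˢ (X ×ˢ X)).filter (fun p => p.2.1 ≠ p.1.1 ∧ p.2.2 ≠ p.1.2)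

lemma wt_sum (X : Finset ℝ) :
    ∑ p ∈ quads X, wt X p ≤ 4 * (X.card : ℝ)^2 * (1 + Real.log X.card) := by
  unfold quads
  rw [Finset.sum_filter, Finset.sum_product]
  have : ∀ q ∈ X ×ˢ X, ∑ q' ∈ X ×ˢ X, (if q'.1 ≠ q.1 ∧ q'.2 ≠ q.2 then wt X (q, q') else 0)
      ≤ 4 * (1 + Real.log X.card) := by
    rintro ⟨x, y⟩ hq
    rw [Finset.mem_product] at hq
    rw [Finset.sum_product]
    have e : ∑ x' ∈ X, ∑ y' ∈ X, (if x' ≠ x ∧ y' ≠ y then wt X ((x,y), (x',y')) else 0)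
        = ∑ x' ∈ X.filter (fun x' => x' ≠ x), ∑ y' ∈ X.filter (fun y' => y' ≠ y),
          1 / ((rd X x x' + rd X y y' : ℕ) : ℝ)^2 := by
      rw [Finset.sum_filter]
      refine Finset.sum_congr rfl fun x' _ => ?_
      by_cases h : x' = x
      · simp [h]
      · simp only [ne_eq, h, not_false_eq_true, true_and, if_true]
        rw [Finset.sum_filter]
        rfl
    change ∑ x' ∈ X, ∑ y' ∈ X, (if x' ≠ x ∧ y' ≠ y then wt X ((x,y), (x',y')) else 0) ≤ _
    rw [e]
    have h1 := rd_sum X x hq.1 (fun g => 2 * ∑ h ∈ Finset.Icc 1 X.card, (1:ℝ) / ((g + h : ℕ) : ℝ)^2)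
      (fun n => by positivity)
    have h2 : ∑ x' ∈ X.filter (fun x' => x' ≠ x), ∑ y' ∈ X.filter (fun y' => y' ≠ y),
          (1:ℝ) / ((rd X x x' + rd X y y' : ℕ) : ℝ)^2 ≤ ∑ x' ∈ X.filter (fun x' => x' ≠ x),
          2 * ∑ h ∈ Finset.Icc 1 X.card, (1:ℝ) / ((rd X x x' + h : ℕ) : ℝ)^2 := by
      apply Finset.sum_le_sum
      intro x' _
      exact rd_sum X y hq.2 (fun h => (1:ℝ) / ((rd X x x' + h : ℕ) : ℝ)^2) (fun n => by positivity)
    have h3 := sum_inv_sq2 X.card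
    rw [← Finset.mul_sum] at h1 h2
    rw [← Finset.mul_sum] at h1
    linarith
  refine (Finset.sum_le_sum this).trans ?_
  rw [Finset.sum_const, Finset.card_product, nsmul_eq_mul]
  push_cast
  apply le_of_eq; ring

/-- Tangent line form of the power mean inequality. -/
lemma pow_mean (m : ℕ) (d : ℕ → ℝ) (hd : ∀ j < m, 0 < d j) (M : ℝ) (hM : 0 < M)
    (hs : ∑ j ∈ Finset.range m, d j ≤ M) :
    (m:ℝ)^3 ≤ M^2 * ∑ j ∈ Finset.range m, 1 / (d j)^2 := by
  rcases Nat.eq_zero_or_pos m with rfl | hm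
  · simp
  have hm' : (0:ℝ) < m := by exact_mod_cast hm
  have h1 : ∀ j ∈ Finset.range m, 3 * (m:ℝ)^2 - 2 * (m:ℝ)^3 * d j / M ≤ M^2 * (1 / (d j)^2) := by
    intro j hj
    have hp := hd j (Finset.mem_range.1 hj)
    have : M^2 * (1 / (d j)^2) - (3 * (m:ℝ)^2 - 2 * (m:ℝ)^3 * d j / M)
       = (M - m * d j)^2 * (M + 2 * m * d j) / (M * (d j)^2) := by
      field_simp
      ring
    have h2 : 0 ≤ (M - m * d j)^2 * (M + 2 * m * d j) / (M * (d j)^2) := by positivity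
    linarith
  rw [Finset.mul_sum]
  refine le_trans ?_ (Finset.sum_le_sum h1)
  rw [Finset.sum_sub_distrib, Finset.sum_const, Finset.card_range, nsmul_eq_mul]
  rw [← Finset.sum_div, ← Finset.mul_sum]
  have : 2 * (m:ℝ)^3 * ∑ j ∈ Finset.range m, d j ≤ 2 * (m:ℝ)^3 * M := by gcongr
  have : 2 * (m:ℝ)^3 * (∑ j ∈ Finset.range m, d j) / M ≤ 2 * (m:ℝ)^3 := by
    rw [div_le_iff₀ hM]; exact this
  nlinarith

/-- enumeration -/
lemma exists_enum_s18 (Y : Finset ℝ) : ∃ y : ℕ → ℝ, (∀ j < Y.card, y j ∈ Y) ∧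
    (∀ i j, i < j → j < Y.card → y i < y j) := by
  refine ⟨fun j => if h : j < Y.card then Y.orderEmbOfFin rfl ⟨j, h⟩ else 0, ?_, ?_⟩
  · intro j hj
    simp only [hj, dif_pos]
    exact Finset.orderEmbOfFin_mem _ _ _
  · intro i j hij hj
    have hi := hij.trans hj
    simp only [hi, hj, dif_pos]
    exact (Y.orderEmbOfFin rfl).strictMono (by simpa using hij)

/-- the sum along one line -/
lemma line_sum (X : Finset ℝ) (l c : ℝ) (hl : l ≠ 0) (y : ℕ → ℝ)
    (hy : ∀ j < (onl X l c).card, y j ∈ onl X l c)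
    (hm : ∀ i j, i < j → j < (onl X l c).card → y i < y j) :
    (((onl X l c).card - 1 : ℕ) : ℝ)^3 ≤ (2 * (X.card:ℝ))^2 *
      ∑ j ∈ Finset.range ((onl X l c).card - 1),
        wt X ((y j, l * y j + c), (y (j+1), l * y (j+1) + c)) := by
  set m := (onl X l c).card - 1 with hmdef
  rcases Nat.eq_zero_or_pos m with h0 | hmpos
  · rw [h0]; simp
  have hX : 0 < X.card := by
    have : (onl X l c).card ≤ X.card := Finset.card_filter_le _ _
    omega
  have hmemX : ∀ j ≤ m, y j ∈ X ∧ l * y j + c ∈ X := by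
    intro j hj
    have := hy j (by omega)
    simpa [onl] using this
  have hlt : ∀ j < m, y j < y (j+1) := fun j hj => hm j (j+1) (by omega) (by omega)
  have hd1 : ∀ j < m, (rd X (y j) (y (j+1)) : ℝ) = (rk X (y (j+1)) : ℝ) - rk X (y j) := by
    intro j hj
    have h := rk_lt (hmemX j hj.le).1 (hlt j hj)
    have : rd X (y j) (y (j+1)) = rk X (y (j+1)) - rk X (y j) := by unfold rd; omega
    rw [this, Nat.cast_sub h.le]
  have hpos : ∀ j < m, 0 < rd X (y j) (y (j+1)) := by
    intro j hj
    have h := rk_lt (hmemX j hj.le).1 (hlt j hj)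
    unfold rd; omega
  have hs1 : ∑ j ∈ Finset.range m, (rd X (y j) (y (j+1)) : ℝ) ≤ X.card := by
    rw [Finset.sum_congr rfl (fun j hj => hd1 j (Finset.mem_range.1 hj)),
      Finset.sum_range_sub (fun j => (rk X (y j) : ℝ))]
    have h1 : (rk X (y m) : ℝ) ≤ X.card := by exact_mod_cast rk_le _ _
    have h2 : (0:ℝ) ≤ rk X (y 0) := Nat.cast_nonneg _
    linarith
  have hs2 : ∑ j ∈ Finset.range m, (rd X (l * y j + c) (l * y (j+1) + c) : ℝ) ≤ X.card := by
    rcases lt_or_gt_of_ne hl with hneg | hpos'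
    · have hd2 : ∀ j < m, (rd X (l * y j + c) (l * y (j+1) + c) : ℝ)
          = (rk X (l * y j + c) : ℝ) - rk X (l * y (j+1) + c) := by
        intro j hj
        have h := rk_lt (hmemX (j+1) hj).2
          (show l * y (j+1) + c < l * y j + c by nlinarith [hlt j hj])
        have : rd X (l * y j + c) (l * y (j+1) + c)
          = rk X (l * y j + c) - rk X (l * y (j+1) + c) := by unfold rd; omega
        rw [this, Nat.cast_sub h.le]
      rw [Finset.sum_congr rfl (fun j hj => hd2 j (Finset.mem_range.1 hj)),
        Finset.sum_range_sub' (fun j => (rk X (l * y j + c) : ℝ))]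
      have h1 : (rk X (l * y 0 + c) : ℝ) ≤ X.card := by exact_mod_cast rk_le _ _
      have h2 : (0:ℝ) ≤ rk X (l * y m + c) := Nat.cast_nonneg _
      linarith
    · have hd2 : ∀ j < m, (rd X (l * y j + c) (l * y (j+1) + c) : ℝ)
          = (rk X (l * y (j+1) + c) : ℝ) - rk X (l * y j + c) := by
        intro j hj
        have h := rk_lt (hmemX j hj.le).2
          (show l * y j + c < l * y (j+1) + c by nlinarith [hlt j hj])
        have : rd X (l * y j + c) (l * y (j+1) + c)
          = rk X (l * y (j+1) + c) - rk X (l * y j + c) := by unfold rd; omega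
        rw [this, Nat.cast_sub h.le]
      rw [Finset.sum_congr rfl (fun j hj => hd2 j (Finset.mem_range.1 hj)),
        Finset.sum_range_sub (fun j => (rk X (l * y j + c) : ℝ))]
      have h1 : (rk X (l * y m + c) : ℝ) ≤ X.card := by exact_mod_cast rk_le _ _
      have h2 : (0:ℝ) ≤ rk X (l * y 0 + c) := Nat.cast_nonneg _
      linarith
  have := pow_mean m (fun j => ((rd X (y j) (y (j+1)) + rd X (l * y j + c) (l * y (j+1) + c) : ℕ) : ℝ))
    (fun j hj => by have := hpos j hj; exact_mod_cast (by omega)) (2 * (X.card:ℝ))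
    (by have : (0:ℝ) < X.card := by exact_mod_cast hX
        linarith)
    (by push_cast; rw [Finset.sum_add_distrib]; linarith)
  simpa [wt] using this

lemma lines_sum (X : Finset ℝ) (Q : Finset (Σ _ : ℝ, ℝ)) (hQ : ∀ q ∈ Q, q.1 ≠ 0) :
    ∑ q ∈ Q, (((onl X q.1 q.2).card - 1 : ℕ) : ℝ)^3 ≤
      16 * (X.card : ℝ)^4 * (1 + Real.log X.card) := by
  choose y hy hm using fun q : (Σ _ : ℝ, ℝ) => exists_enum_s18 (onl X q.1 q.2)
  have h1 := Finset.sum_le_sum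
    (fun q (hq : q ∈ Q) => line_sum X q.1 q.2 (hQ q hq) (y q) (hy q) (hm q))
  refine h1.trans ?_
  rw [← Finset.mul_sum, Finset.sum_sigma' Q]
  have hinj : ∑ p ∈ Q.sigma (fun q => Finset.range ((onl X q.1 q.2).card - 1)),
      wt X ((y p.1 p.2, p.1.1 * y p.1 p.2 + p.1.2), (y p.1 (p.2+1), p.1.1 * y p.1 (p.2+1) + p.1.2))
      ≤ ∑ p ∈ quads X, wt X p := by
    have hi : Set.InjOn (fun p : (Σ _ : (Σ _ : ℝ, ℝ), ℕ) =>
        ((y p.1 p.2, p.1.1 * y p.1 p.2 + p.1.2), (y p.1 (p.2+1), p.1.1 * y p.1 (p.2+1) + p.1.2)))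
        (Q.sigma (fun q => Finset.range ((onl X q.1 q.2).card - 1))) := by
      rintro ⟨⟨l, c⟩, j⟩ hp ⟨⟨l', c'⟩, j'⟩ hp' h
      simp only [Finset.coe_sigma, Set.mem_sigma_iff, Finset.mem_coe, Finset.mem_range] at hp hp'
      simp only [Prod.mk.injEq] at h
      obtain ⟨⟨e1, e2⟩, e3, e4⟩ := h
      have hlt := hm ⟨l, c⟩ j (j+1) (by omega) (by have := hp.2; dsimp only at this ⊢; omega)
      have hl : l = l' := by
        rw [← e1] at e2
        rw [← e3] at e4
        have : (l - l') * (y ⟨l,c⟩ (j+1) - y ⟨l,c⟩ j) = 0 := by linarith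
        rcases mul_eq_zero.1 this with h | h
        · linarith
        · linarith
      subst hl
      have hc : c = c' := by rw [← e1] at e2; linarith
      subst hc
      have hj : j = j' := by
        have a1 := hp.2
        have a2 := hp'.2
        rcases lt_trichotomy j j' with h | h | h
        · have := hm ⟨l, c⟩ j j' h (by dsimp only; omega)
          linarith
        · exact h
        · have := hm ⟨l, c⟩ j' j h (by dsimp only; omega)
          linarith
      subst hj
      rfl
    rw [← Finset.sum_image (f := wt X) hi]
    apply Finset.sum_le_sum_of_subset_of_nonneg
    · intro z hz
      rw [Finset.mem_image] at hz
      obtain ⟨⟨⟨l, c⟩, j⟩, hp, rfl⟩ := hz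
      simp only [Finset.mem_sigma, Finset.mem_range] at hp
      have hl := hQ _ hp.1
      have b1 := hy ⟨l, c⟩ j (by dsimp only; omega)
      have b2 := hy ⟨l, c⟩ (j+1) (by dsimp only; omega)
      have b3 := hm ⟨l, c⟩ j (j+1) (by omega) (by dsimp only; omega)
      simp only [onl, Finset.mem_filter] at b1 b2
      simp only [quads, Finset.mem_filter, Finset.mem_product]
      refine ⟨⟨b1, b2⟩, b3.ne', ?_⟩
      intro h
      have : l * y ⟨l, c⟩ (j+1) = l * y ⟨l, c⟩ j := by linarith
      exact b3.ne' (mul_left_cancel₀ hl this)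
    · intros; unfold wt; positivity
  have h2 := wt_sum X
  calc _ ≤ (2 * (X.card:ℝ))^2 * (4 * (X.card : ℝ)^2 * (1 + Real.log X.card)) := by
        apply mul_le_mul_of_nonneg_left (hinj.trans h2) (by positivity)
    _ = _ := by ring

/-- pointwise inequality -/
lemma ptw (r g : ℕ) (hr : 1 ≤ r) (hg : 1 ≤ g) (w : ℝ) (hw : 0 < w) (hw1 : w ≤ 1) :
    (r:ℝ)^2 * g ≤ 8 * (w * ((r - 1 : ℕ) : ℝ)^3 + ((g - 1 : ℕ):ℝ)^3 / w^2 + r * g / w) := by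
  have hr' : (1:ℝ) ≤ r := by exact_mod_cast hr
  have hg' : (1:ℝ) ≤ g := by exact_mod_cast hg
  rw [Nat.cast_sub hr, Nat.cast_sub hg]
  push_cast
  have hr1 : (0:ℝ) ≤ r - 1 := by linarith
  have hg1 : (0:ℝ) ≤ g - 1 := by linarith
  have hrg : 0 ≤ (r:ℝ) * g := by positivity
  have t1 : 0 ≤ w * ((r:ℝ) - 1)^3 := by positivity
  have t2 : 0 ≤ ((g:ℝ) - 1)^3 / w^2 := by positivity
  have t3 : (r:ℝ) * g ≤ r * g / w := by
    rw [le_div_iff₀ hw]; nlinarith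
  rcases Nat.eq_or_lt_of_le hr with h | h
  · subst h
    push_cast at *
    nlinarith
  have h2 : (2:ℝ) ≤ r := by exact_mod_cast h
  have c1 : (r:ℝ)^3 ≤ 8 * (r - 1)^3 := by
    have : (r:ℝ)^3 ≤ (2 * (r-1))^3 := by gcongr; linarith
    nlinarith
  have c1' : w * (r:ℝ)^3 ≤ 8 * (w * (r - 1)^3) := by nlinarith
  rcases Nat.eq_or_lt_of_le hg with h' | h'
  · subst h'
    push_cast at *
    have : (r:ℝ)^2 ≤ w * r^3 + r / w := by
      have : w * (r:ℝ)^3 + r / w - r^2 = r * ((w * r - 1)^2 + w * r) / w := by field_simp; ring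
      have : 0 ≤ (r:ℝ) * ((w * r - 1)^2 + w * r) / w := by positivity
      linarith
    have : 0 ≤ (r:ℝ) / w := by positivity
    simp only [mul_one] at *
    linarith
  · have h2' : (2:ℝ) ≤ g := by exact_mod_cast h'
    have c2 : (g:ℝ)^3 ≤ 8 * (g - 1)^3 := by
      have : (g:ℝ)^3 ≤ (2 * (g-1))^3 := by gcongr; linarith
      nlinarith
    have c2' : (g:ℝ)^3 / w^2 ≤ 8 * ((g - 1)^3 / w^2) := by
      rw [← mul_div_assoc]; gcongr
    have : (r:ℝ)^2 * g ≤ w * r^3 + g^3 / w^2 := by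
      by_cases hc : (g:ℝ) ≤ w * r
      · have : (r:ℝ)^2 * g ≤ r^2 * (w * r) := by gcongr
        have : 0 ≤ (g:ℝ)^3 / w^2 := by positivity
        nlinarith
      · push Not at hc
        have : (r:ℝ)^2 * g ≤ g^3 / w^2 := by
          rw [le_div_iff₀ (by positivity)]
          have : (w * r)^2 ≤ (g:ℝ)^2 := by gcongr
          nlinarith
        have : 0 ≤ w * (r:ℝ)^3 := by positivity
        linarith
    have : 0 ≤ (r:ℝ) * g / w := by positivity
    linarith

/-- the ratio count -/
noncomputable def rat (A : Finset ℝ) (l : ℝ) : Finset ℝ := A.filter (fun x => l * x ∈ A)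

noncomputable def ratios (A : Finset ℝ) : Finset ℝ := (A ×ˢ A).image (fun p => p.1 / p.2)

noncomputable def en (A : Finset ℝ) : Finset (ℝ × ℝ × ℝ × ℝ) :=
  (A ×ˢ A ×ˢ A ×ˢ A).filter (fun q => q.1 * q.2.1 = q.2.2.1 * q.2.2.2)

lemma en_le (A : Finset ℝ) (hA : (0:ℝ) ∉ A) : (en A).card ≤ ∑ l ∈ ratios A, (rat A l).card^2 := by
  have hne : ∀ a ∈ A, a ≠ 0 := fun a ha h => hA (h ▸ ha)
  rw [Finset.card_eq_sum_card_fiberwise (f := fun q : ℝ × ℝ × ℝ × ℝ => q.1 / q.2.2.1) (t := ratios A)]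
  · apply Finset.sum_le_sum
    intro l _
    rw [sq, ← Finset.card_product]
    apply Finset.card_le_card_of_injOn (fun q => (q.2.2.1, q.2.1))
    · rintro ⟨a, b, c, d⟩ h
      simp only [en, Finset.coe_filter, Finset.mem_filter, Finset.mem_product, Set.mem_ofPred_eq] at h
      obtain ⟨⟨⟨ha, hb, hc, hd⟩, he⟩, rfl⟩ := h
      have := hne c hc
      simp only [rat, Finset.coe_product, Set.mem_prod, Finset.mem_coe, Finset.mem_filter]
      refine ⟨⟨hc, ?_⟩, hb, ?_⟩
      · rw [div_mul_cancel₀ _ this]; exact ha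
      · rw [div_mul_eq_mul_div, he, mul_div_cancel_left₀ _ this]; exact hd
    · rintro ⟨a, b, c, d⟩ h ⟨a', b', c', d'⟩ h' e
      simp only [en, Finset.coe_filter, Finset.mem_filter, Finset.mem_product, Set.mem_ofPred_eq] at h h'
      simp only [Prod.mk.injEq] at e
      obtain ⟨rfl, rfl⟩ := e
      obtain ⟨⟨⟨ha, hb, hc, hd⟩, he⟩, hl⟩ := h
      obtain ⟨⟨_, he'⟩, hl'⟩ := h'
      have := hne c hc
      have e1 : a = a' := by
        rw [← hl'] at hl
        exact (div_left_inj' this).1 hl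
      subst e1
      have e2 : d = d' := mul_left_cancel₀ this (he.symm.trans he')
      subst e2
      rfl
  · rintro ⟨a, b, c, d⟩ h
    simp only [en, Finset.coe_filter, Finset.mem_product, Set.mem_ofPred_eq] at h
    simp only [ratios, Finset.coe_image, Set.mem_image, Finset.mem_coe, Finset.mem_product, Prod.exists]
    exact ⟨a, c, ⟨h.1.1, h.1.2.2.1⟩, rfl⟩

lemma rat_sum (A : Finset ℝ) (hA : (0:ℝ) ∉ A) : ∑ l ∈ ratios A, (rat A l).card ≤ A.card^2 := by
  have hne : ∀ a ∈ A, a ≠ 0 := fun a ha h => hA (h ▸ ha)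
  rw [← Finset.card_sigma, sq, ← Finset.card_product]
  apply Finset.card_le_card_of_injOn (fun p => (p.2, p.1 * p.2))
  · rintro ⟨l, x⟩ h
    simp only [rat, Finset.coe_sigma, Set.mem_sigma_iff, Finset.mem_coe, Finset.mem_filter] at h
    simp only [Finset.coe_product, Set.mem_prod, Finset.mem_coe]
    exact h.2
  · rintro ⟨l, x⟩ h ⟨l', x'⟩ h' e
    simp only [rat, Finset.coe_sigma, Set.mem_sigma_iff, Finset.mem_coe, Finset.mem_filter] at h
    simp only [Prod.mk.injEq] at e
    obtain ⟨rfl, e⟩ := e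
    have := mul_right_cancel₀ (hne x h.2.1) e
    subst this
    rfl

lemma rat_pos (A : Finset ℝ) (hA : (0:ℝ) ∉ A) (l : ℝ) (hl : l ∈ ratios A) :
    1 ≤ (rat A l).card ∧ l ≠ 0 := by
  have hne : ∀ a ∈ A, a ≠ 0 := fun a ha h => hA (h ▸ ha)
  simp only [ratios, Finset.mem_image, Finset.mem_product, Prod.exists] at hl
  obtain ⟨a, b, ⟨ha, hb⟩, rfl⟩ := hl
  refine ⟨Finset.card_pos.2 ⟨b, ?_⟩, div_ne_zero (hne a ha) (hne b hb)⟩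
  simp only [rat, Finset.mem_filter]
  exact ⟨hb, by rw [div_mul_cancel₀ _ (hne b hb)]; exact ha⟩

noncomputable def cs (B : Finset ℝ) (l : ℝ) : Finset ℝ := (B ×ˢ B).image (fun p => p.2 - l * p.1)

lemma onl_sum (B : Finset ℝ) (l : ℝ) : ∑ c ∈ cs B l, (onl B l c).card = B.card^2 := by
  rw [sq, ← Finset.card_product, cs, Finset.card_eq_sum_card_image (fun p : ℝ × ℝ => p.2 - l * p.1)]
  refine Finset.sum_congr rfl fun c _ => ?_
  apply Finset.card_bij (fun b _ => (b, l * b + c))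
  · intro b hb
    simp only [onl, Finset.mem_filter] at hb
    simp only [Finset.mem_filter, Finset.mem_product]
    exact ⟨hb, by ring⟩
  · intro b _ b' _ h
    exact (Prod.mk.injEq _ _ _ _ ▸ h).1
  · rintro ⟨b, b'⟩ h
    simp only [Finset.mem_filter, Finset.mem_product] at h
    obtain ⟨⟨h1, h2⟩, rfl⟩ := h
    refine ⟨b, ?_, ?_⟩
    · simp only [onl, Finset.mem_filter]
      exact ⟨h1, by rw [add_sub_cancel]; exact h2⟩
    · simp

lemma cs_prop (A B : Finset ℝ) (l c : ℝ) (hc : c ∈ cs B l) :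
    1 ≤ (onl B l c).card ∧ (rat A l).card ≤ (onl (A + B) l c).card := by
  simp only [cs, Finset.mem_image, Finset.mem_product, Prod.exists] at hc
  obtain ⟨b, b', ⟨hb, hb'⟩, rfl⟩ := hc
  constructor
  · refine Finset.card_pos.2 ⟨b, ?_⟩
    simp only [onl, Finset.mem_filter]
    exact ⟨hb, by rw [add_sub_cancel]; exact hb'⟩
  · apply Finset.card_le_card_of_injOn (fun x => x + b)
    · intro x hx
      simp only [rat, Finset.coe_filter, Set.mem_ofPred_eq] at hx
      simp only [onl, Finset.coe_filter, Set.mem_ofPred_eq]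
      refine ⟨Finset.add_mem_add hx.1 hb, ?_⟩
      have : l * (x + b) + (b' - l * b) = l * x + b' := by ring
      rw [this]
      exact Finset.add_mem_add hx.2 hb'
    · intro x _ x' _ h
      exact add_right_cancel h

lemma main_ineq (A B : Finset ℝ) (hA : (0:ℝ) ∉ A) (hA2 : A.Nonempty) (hB : B.Nonempty) :
    (B.card : ℝ) * (en A).card ≤ 264 * ((A + B).card : ℝ)^3 * (1 + Real.log (A + B).card) := by
  set N : ℝ := ((A + B).card : ℝ) with hN
  set b : ℝ := (B.card : ℝ) with hb
  have hb0 : 1 ≤ b := by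
    have := hB.card_pos
    rw [hb]; exact_mod_cast this
  have hbN : b ≤ N := by
    rw [hb, hN]; exact_mod_cast Finset.card_le_card_add_left hA2
  have haN : (A.card : ℝ) ≤ N := by
    rw [hN]; exact_mod_cast Finset.card_le_card_add_right hB
  have hlog0 : 0 ≤ Real.log N := Real.log_nonneg (by linarith)
  have hlogb : Real.log b ≤ Real.log N := Real.log_le_log (by linarith) hbN
  set w := b / N with hw
  have hNpos : 0 < N := by linarith
  have hw0 : 0 < w := by positivity
  have hw1 : w ≤ 1 := by rw [hw, div_le_one hNpos]; exact hbN
  set Q : Finset (Σ _ : ℝ, ℝ) := (ratios A).sigma (cs B) with hQ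
  have hQ0 : ∀ q ∈ Q, q.1 ≠ 0 := fun q hq => (rat_pos A hA q.1 (Finset.mem_sigma.1 hq).1).2
  have S1 := lines_sum (A + B) Q hQ0
  have S2 := lines_sum B Q hQ0
  have E1 : b^2 * ((en A).card : ℝ) ≤ ∑ q ∈ Q, ((rat A q.1).card : ℝ)^2 * (onl B q.1 q.2).card := by
    rw [hQ, Finset.sum_sigma]
    have : ∀ l ∈ ratios A, ∑ c ∈ cs B l, ((rat A l).card : ℝ)^2 * ((onl B l c).card : ℝ)
        = ((rat A l).card : ℝ)^2 * b^2 := by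
      intro l _
      rw [← Finset.mul_sum]
      congr 1
      rw [hb]
      exact_mod_cast onl_sum B l
    rw [Finset.sum_congr rfl this, ← Finset.sum_mul, mul_comm]
    have h := en_le A hA
    have h' : ((en A).card : ℝ) ≤ ∑ l ∈ ratios A, ((rat A l).card : ℝ)^2 := by exact_mod_cast h
    gcongr
  have E3 : ∑ q ∈ Q, ((rat A q.1).card : ℝ) * (onl B q.1 q.2).card ≤ N^2 * b^2 := by
    rw [hQ, Finset.sum_sigma]
    have : ∀ l ∈ ratios A, ∑ c ∈ cs B l, ((rat A l).card : ℝ) * ((onl B l c).card : ℝ)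
        = ((rat A l).card : ℝ) * b^2 := by
      intro l _
      rw [← Finset.mul_sum]
      congr 1
      rw [hb]
      exact_mod_cast onl_sum B l
    rw [Finset.sum_congr rfl this, ← Finset.sum_mul]
    have h := rat_sum A hA
    have h' : ∑ l ∈ ratios A, ((rat A l).card : ℝ) ≤ (A.card : ℝ)^2 := by exact_mod_cast h
    have h'' : (A.card : ℝ)^2 ≤ N^2 := by gcongr
    have := h'.trans h''
    gcongr
  have E2 : ∑ q ∈ Q, ((rat A q.1).card : ℝ)^2 * (onl B q.1 q.2).card ≤
      ∑ q ∈ Q, 8 * (w * (((onl (A+B) q.1 q.2).card - 1 : ℕ) : ℝ)^3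
        + (((onl B q.1 q.2).card - 1 : ℕ):ℝ)^3 / w^2
        + (rat A q.1).card * (onl B q.1 q.2).card / w) := by
    apply Finset.sum_le_sum
    intro q hq
    rw [hQ, Finset.mem_sigma] at hq
    have h1 := (rat_pos A hA q.1 hq.1).1
    have h2 := cs_prop A B q.1 q.2 hq.2
    refine (ptw _ _ h1 h2.1 w hw0 hw1).trans ?_
    have h3 : ((rat A q.1).card - 1) ≤ (onl (A+B) q.1 q.2).card - 1 := by have := h2.2; omega
    have h4 : (((rat A q.1).card - 1 : ℕ) : ℝ) ≤ (((onl (A+B) q.1 q.2).card - 1 : ℕ) : ℝ) := by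
      exact_mod_cast h3
    gcongr
  rw [← Finset.mul_sum, Finset.sum_add_distrib, Finset.sum_add_distrib, ← Finset.mul_sum,
    ← Finset.sum_div, ← Finset.sum_div] at E2
  have F1 := mul_le_mul_of_nonneg_left S1 hw0.le
  have F2 := div_le_div_of_nonneg_right S2 (sq_nonneg w)
  have F3 := div_le_div_of_nonneg_right E3 hw0.le
  have G1 : w * (16 * N^4 * (1 + Real.log N)) = b * (16 * N^3 * (1 + Real.log N)) := by
    rw [hw]; field_simp
  have G2 : 16 * b^4 * (1 + Real.log b) / w^2 ≤ b * (16 * N^3 * (1 + Real.log N)) := by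
    have : 16 * b^4 * (1 + Real.log b) / w^2 = b * (16 * (N^2 * b) * (1 + Real.log b)) := by
      rw [hw]; field_simp
    rw [this]
    have h1 : N^2 * b ≤ N^3 := by nlinarith [sq_nonneg N]
    have h2 : 16 * (N^2 * b) * (1 + Real.log b) ≤ 16 * (N^2 * b) * (1 + Real.log N) := by gcongr
    have h3 : 16 * (N^2 * b) * (1 + Real.log N) ≤ 16 * (N^3) * (1 + Real.log N) := by gcongr
    exact mul_le_mul_of_nonneg_left (h2.trans h3) (by linarith)
  have G3 : N^2 * b^2 / w = b * N^3 := by rw [hw]; field_simp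
  have G4 : b * N^3 ≤ b * (N^3 * (1 + Real.log N)) := by
    have : 0 ≤ N^3 * Real.log N := by positivity
    apply mul_le_mul_of_nonneg_left _ (by linarith)
    linarith
  have fin : b * (b * (en A).card) ≤ b * (264 * N^3 * (1 + Real.log N)) := by
    nlinarith
  exact le_of_mul_le_mul_left fin (by linarith)

lemma en_cube (A : Finset ℝ) (hA : (0:ℝ) ∉ A) : (en A).card ≤ A.card^3 := by
  refine (en_le A hA).trans ?_
  calc _ ≤ ∑ l ∈ ratios A, A.card * (rat A l).card := by
        apply Finset.sum_le_sum
        intro l _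
        rw [sq]
        exact Nat.mul_le_mul_right _ (Finset.card_filter_le _ _)
    _ = A.card * ∑ l ∈ ratios A, (rat A l).card := by rw [Finset.mul_sum]
    _ ≤ A.card * A.card^2 := Nat.mul_le_mul_left _ (rat_sum A hA)
    _ = _ := by ring

lemma en_lower (A : Finset ℝ) : A.card^4 ≤ (A * A).card * (en A).card := by
  have h := le_card_mul_mul_mulEnergy A A
  have e : mulEnergy A A ≤ (en A).card := by
    unfold mulEnergy
    apply Finset.card_le_card_of_injOn (fun x => (x.1.1, x.2.1, x.1.2, x.2.2))
    · rintro ⟨⟨a, b⟩, c, d⟩ hx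
      simp only [Finset.coe_filter, Finset.mem_product, Set.mem_ofPred_eq] at hx
      simp only [en, Finset.coe_filter, Finset.mem_product, Set.mem_ofPred_eq]
      tauto
    · rintro ⟨⟨a, b⟩, c, d⟩ _ ⟨⟨a', b'⟩, c', d'⟩ _ hx
      simp only [Prod.mk.injEq] at hx ⊢
      tauto
  calc A.card^4 = A.card^2 * A.card^2 := by ring
    _ ≤ _ := h
    _ ≤ _ := Nat.mul_le_mul_left _ e

theorem stmt18 : ∃ c > (0:ℝ), ∀ A B : Finset ℝ, (0:ℝ) ∉ A → 2 ≤ A.card →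
    c * ((B.card : ℝ) *
        (((A ×ˢ A ×ˢ A ×ˢ A).filter
          (fun q => q.1 * q.2.1 = q.2.2.1 * q.2.2.2)).card : ℝ) /
        Real.logb 2 (A.card : ℝ)) ≤ ((A + B).card : ℝ)^3 ∧
    (A.card : ℝ)^4 * (B.card : ℝ) / (((A * A).card : ℝ) * Real.logb 2 (A.card : ℝ)) ≤
      (B.card : ℝ) *
        (((A ×ˢ A ×ˢ A ×ˢ A).filter
          (fun q => q.1 * q.2.1 = q.2.2.1 * q.2.2.2)).card : ℝ) /
        Real.logb 2 (A.card : ℝ) := by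
  refine ⟨1 / 1056, by norm_num, ?_⟩
  intro A B hA hcard
  change 1 / 1056 * ((B.card : ℝ) * ((en A).card : ℝ) / Real.logb 2 (A.card : ℝ)) ≤ _ ∧
    _ ≤ (B.card : ℝ) * ((en A).card : ℝ) / Real.logb 2 (A.card : ℝ)
  have hA2 : A.Nonempty := Finset.card_pos.1 (by omega)
  have ha : (2:ℝ) ≤ A.card := by exact_mod_cast hcard
  have hL : 1 ≤ Real.logb 2 (A.card : ℝ) := by
    rw [Real.le_logb_iff_rpow_le (by norm_num) (by linarith)]
    simpa using ha
  have hL0 : 0 < Real.logb 2 (A.card : ℝ) := by linarith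
  constructor
  · rcases B.eq_empty_or_nonempty with rfl | hB
    · simp
    have hbN : (B.card:ℝ) ≤ (A+B).card := by exact_mod_cast Finset.card_le_card_add_left hA2
    have hb0 : (1:ℝ) ≤ B.card := by exact_mod_cast hB.card_pos
    have hE : ((en A).card : ℝ) ≤ (A.card : ℝ)^3 := by exact_mod_cast en_cube A hA
    rw [← mul_div_assoc, div_le_iff₀ hL0]
    have hN3 : (0:ℝ) ≤ ((A+B).card : ℝ)^3 := by positivity
    by_cases hc : (A.card:ℝ)^2 ≤ B.card
    · have h1 : ((en A).card : ℝ) ≤ (B.card:ℝ)^2 := by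
        have : (A.card : ℝ)^3 ≤ ((A.card:ℝ)^2)^2 := by
          rw [← pow_mul]; exact pow_le_pow_right₀ (by linarith) (by norm_num)
        have : ((A.card:ℝ)^2)^2 ≤ (B.card:ℝ)^2 := by gcongr
        linarith
      have h2 : (B.card:ℝ) * (en A).card ≤ (B.card:ℝ) * (B.card:ℝ)^2 := by gcongr
      have h3 : (B.card:ℝ)^3 ≤ ((A+B).card : ℝ)^3 := by gcongr
      nlinarith
    · push Not at hc
      have hm := main_ineq A B hA hA2 hB
      have hN : ((A+B).card : ℝ) ≤ (A.card:ℝ)^3 := by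
        have : ((A+B).card : ℝ) ≤ A.card * B.card := by exact_mod_cast Finset.card_add_le
        nlinarith
      have hlog : Real.log (A+B).card ≤ 3 * Real.logb 2 A.card := by
        have h1 : Real.log (A+B).card ≤ Real.log ((A.card:ℝ)^3) :=
          Real.log_le_log (by linarith) hN
        rw [Real.log_pow] at h1
        push_cast at h1
        have h2 : Real.log A.card ≤ Real.logb 2 A.card := by
          rw [Real.logb, le_div_iff₀ (Real.log_pos (by norm_num))]
          have := Real.log_two_lt_d9
          have : 0 ≤ Real.log A.card := Real.log_nonneg (by linarith)
          nlinarith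
        linarith
      have : 264 * ((A + B).card : ℝ)^3 * (1 + Real.log (A + B).card)
          ≤ 264 * ((A + B).card : ℝ)^3 * (4 * Real.logb 2 A.card) := by
        gcongr
        linarith
      linarith
  · have hl : (A.card:ℝ)^4 ≤ (A*A).card * (en A).card := by exact_mod_cast en_lower A
    have hAA : (0:ℝ) < (A*A).card := by exact_mod_cast (hA2.mul hA2).card_pos
    rw [← div_div]
    gcongr
    rw [div_le_iff₀ hAA]
    have := mul_le_mul_of_nonneg_right hl (Nat.cast_nonneg (α := ℝ) B.card)
    linarith
end
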